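/- (Unbounded violations for three-player XOR games.) There exists a constant C > 0 such that for every integer n ≥ 2 there exists a three-player XOR game tensor Ĝ ∈ ℝ^{n²×n²×n²} with Σ_{x,y,z} |Ĝ_{xyz}| = 1 satisfying β*_n(Ĝ) ≥ C (√n / log^{3/2} n) · β(Ĝ); in particular β*(Ĝ) ≥ C (√n / log^{3/2} n) · β(Ĝ), with the entangled bias lower bound witnessed by a quantum strategy of local dimension n per player. -/

import Mathlib

/-- A matrix has operator norm (on `ℓ₂`) at most one. -/
def IsContraction {d : ℕ} (A : Matrix (Fin d) (Fin d) ℂ) : Prop :=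
  ∀ v : Fin d → ℂ,
    ∑ i, ‖A.mulVec v i‖ ^ 2 ≤ ∑ i, ‖v i‖ ^ 2

/-- The classical bias of the three-player XOR game with tensor `G`. -/
noncomputable def xorCBias3 {n₁ n₂ n₃ : ℕ}
    (G : Fin n₁ → Fin n₂ → Fin n₃ → ℝ) : ℝ :=
  sSup {r : ℝ | ∃ (a : Fin n₁ → ℝ) (b : Fin n₂ → ℝ) (c : Fin n₃ → ℝ),
    (∀ x, |a x| ≤ 1) ∧ (∀ y, |b y| ≤ 1) ∧ (∀ z, |c z| ≤ 1) ∧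
    r = |∑ x, ∑ y, ∑ z, G x y z * a x * b y * c z|}

/-- The entangled bias of the three-player XOR game with tensor `G`, restricted to
strategies of local (per-player) dimension at most `D`. -/
noncomputable def xorQBias3Dim {n₁ n₂ n₃ : ℕ} (D : ℕ)
    (G : Fin n₁ → Fin n₂ → Fin n₃ → ℝ) : ℝ :=
  sSup {r : ℝ | ∃ (d : ℕ) (ψ : Fin d × Fin d × Fin d → ℂ)
      (A : Fin n₁ → Matrix (Fin d) (Fin d) ℂ) (B : Fin n₂ → Matrix (Fin d) (Fin d) ℂ)
      (C : Fin n₃ → Matrix (Fin d) (Fin d) ℂ),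
    1 ≤ d ∧ d ≤ D ∧ (∑ p, ‖ψ p‖ ^ 2 = 1) ∧
    (∀ x, IsContraction (A x)) ∧ (∀ y, IsContraction (B y)) ∧
    (∀ z, IsContraction (C z)) ∧
    r = ‖(∑ x, ∑ y, ∑ z, (G x y z : ℂ) *
          ∑ p : Fin d × Fin d × Fin d, ∑ q : Fin d × Fin d × Fin d,
            (starRingEnd ℂ) (ψ p) *
              (A x p.1 q.1 * B y p.2.1 q.2.1 * C z p.2.2 q.2.2) * ψ q : ℂ)‖}

/-- The (unrestricted) entangled bias of the three-player XOR game with tensor `G`. -/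
noncomputable def xorQBias3 {n₁ n₂ n₃ : ℕ}
    (G : Fin n₁ → Fin n₂ → Fin n₃ → ℝ) : ℝ :=
  sSup {r : ℝ | ∃ (d : ℕ) (ψ : Fin d × Fin d × Fin d → ℂ)
      (A : Fin n₁ → Matrix (Fin d) (Fin d) ℂ) (B : Fin n₂ → Matrix (Fin d) (Fin d) ℂ)
      (C : Fin n₃ → Matrix (Fin d) (Fin d) ℂ),
    1 ≤ d ∧ (∑ p, ‖ψ p‖ ^ 2 = 1) ∧
    (∀ x, IsContraction (A x)) ∧ (∀ y, IsContraction (B y)) ∧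
    (∀ z, IsContraction (C z)) ∧
    r = ‖(∑ x, ∑ y, ∑ z, (G x y z : ℂ) *
          ∑ p : Fin d × Fin d × Fin d, ∑ q : Fin d × Fin d × Fin d,
            (starRingEnd ℂ) (ψ p) *
              (A x p.1 q.1 * B y p.2.1 q.2.1 * C z p.2.2 q.2.2) * ψ q : ℂ)‖}

section helpers
open Matrix
open scoped Kronecker

/-- contraction for rectangular matrices -/
def Ctr {𝕜 m n : Type*} [RCLike 𝕜] [Fintype m] [Fintype n] (A : Matrix m n 𝕜) : Prop :=
  ∀ v : n → 𝕜, ∑ i, ‖(A *ᵥ v) i‖ ^ 2 ≤ ∑ i, ‖v i‖ ^ 2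

section ctr
variable {𝕜 m n l m' n' : Type*} [RCLike 𝕜] [Fintype m] [Fintype n] [Fintype l] [Fintype m'] [Fintype n']

theorem Ctr.mul {A : Matrix l m 𝕜} {B : Matrix m n 𝕜} (hA : Ctr A) (hB : Ctr B) : Ctr (A * B) := by
  intro v
  rw [← Matrix.mulVec_mulVec]
  exact (hA _).trans (hB _)

theorem Ctr.kron {A : Matrix m m' 𝕜} {B : Matrix n n' 𝕜} (hA : Ctr A) (hB : Ctr B) :
    Ctr (A ⊗ₖ B) := by
  intro v
  have h1 : ∀ i j, ((A ⊗ₖ B) *ᵥ v) (i, j) =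
      (A *ᵥ (fun i' => (B *ᵥ (fun j' => v (i', j'))) j)) i := by
    intro i j
    simp only [Matrix.mulVec, dotProduct, Matrix.kroneckerMap_apply, Fintype.sum_prod_type,
      Finset.mul_sum, mul_assoc]
  rw [Fintype.sum_prod_type, Fintype.sum_prod_type, Finset.sum_comm]
  simp only [h1]
  calc _ ≤ ∑ j, ∑ i', ‖(B *ᵥ (fun j' => v (i', j'))) j‖ ^ 2 :=
        Finset.sum_le_sum fun j _ => hA _
    _ = ∑ i', ∑ j, ‖(B *ᵥ (fun j' => v (i', j'))) j‖ ^ 2 := Finset.sum_comm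
    _ ≤ _ := Finset.sum_le_sum fun j _ => hB _

open scoped Matrix.Norms.L2Operator in
theorem ctr_iff_norm [DecidableEq n] {A : Matrix m n 𝕜} : Ctr A ↔ ‖A‖ ≤ 1 := by
  rw [Matrix.l2_opNorm_def, ContinuousLinearMap.opNorm_le_iff zero_le_one]
  have key : ∀ v : EuclideanSpace 𝕜 n, (toEuclideanLin.trans LinearMap.toContinuousLinearMap A) v = WithLp.toLp 2 (A *ᵥ v.ofLp) := by
    intro v; rfl
  constructor
  · intro h v
    rw [key, one_mul, EuclideanSpace.norm_eq, EuclideanSpace.norm_eq]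
    exact Real.sqrt_le_sqrt (h v.ofLp)
  · intro h v
    have := h (WithLp.toLp 2 v)
    rw [key, one_mul, EuclideanSpace.norm_eq, EuclideanSpace.norm_eq] at this
    rwa [Real.sqrt_le_sqrt_iff (Finset.sum_nonneg fun i _ => by positivity)] at this

theorem Ctr.transpose {A : Matrix m n ℝ} (h : Ctr A) : Ctr Aᵀ := by
  classical
  rw [ctr_iff_norm] at h ⊢
  rw [← Matrix.conjTranspose_eq_transpose_of_trivial, Matrix.l2_opNorm_conjTranspose]
  exact h

theorem Ctr.sq {A : Matrix m n ℝ} (h : Ctr A) (v : n → ℝ) :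
    ∑ i, (A *ᵥ v) i ^ 2 ≤ ∑ i, v i ^ 2 := by
  simpa using h v

theorem ctr_of_sq {A : Matrix m n ℝ} (h : ∀ v : n → ℝ,
    ∑ i, (A *ᵥ v) i ^ 2 ≤ ∑ i, v i ^ 2) : Ctr A := by
  intro v; simpa using h v

theorem ctr_of_diag [DecidableEq n] {A : Matrix m n ℝ} (d : n → ℝ) (hd : ∀ i, d i ≤ 1)
    (h : Aᵀ * A = diagonal d) : Ctr A := by
  refine ctr_of_sq fun v => ?_
  have h1 : ∑ i, (A *ᵥ v) i ^ 2 = v ⬝ᵥ ((Aᵀ * A) *ᵥ v) := by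
    rw [← Matrix.mulVec_mulVec, Matrix.dotProduct_mulVec, Matrix.vecMul_transpose]
    simp [dotProduct, sq]
  rw [h1, h]
  simp only [dotProduct, mulVec_diagonal]
  refine Finset.sum_le_sum fun i _ => ?_
  nlinarith [hd i, sq_nonneg (v i)]
end ctr

theorem exists_net (E : Type*) [NormedAddCommGroup E] [NormedSpace ℝ E] [FiniteDimensional ℝ E] :
    ∃ N : Finset E, (∀ y ∈ N, ‖y‖ ≤ 1) ∧ N.card ≤ 5 ^ Module.finrank ℝ E ∧
      ∀ (f : E →ₗ[ℝ] ℝ) (c : ℝ), (∀ y ∈ N, |f y| ≤ c) → ∀ x, ‖x‖ ≤ 1 → |f x| ≤ 2 * c := by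
  classical
  -- maximal 1/2-separated set
  let P : Finset E → Prop := fun s => (∀ y ∈ s, ‖y‖ ≤ 1) ∧
    ∀ c ∈ s, ∀ d ∈ s, c ≠ d → 1 / 2 ≤ ‖c - d‖
  have hcard : ∀ s, P s → s.card ≤ 5 ^ Module.finrank ℝ E := by
    intro s hs
    have hinj : Function.Injective (fun x : E => (2 : ℝ) • x) := smul_right_injective E two_ne_zero
    rw [← Finset.card_image_of_injective s hinj]
    apply Besicovitch.card_le_of_separated
    · intro c hc
      obtain ⟨y, hy, rfl⟩ := Finset.mem_image.1 hc
      rw [norm_smul]; have := hs.1 y hy; norm_num; linarith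
    · intro c hc d hd hcd
      obtain ⟨y, hy, rfl⟩ := Finset.mem_image.1 hc
      obtain ⟨z, hz, rfl⟩ := Finset.mem_image.1 hd
      have := hs.2 y hy z hz (fun h => hcd (by rw [h]))
      rw [← smul_sub, norm_smul]; norm_num; linarith
  have hex : ∃ k, ∃ s, P s ∧ s.card = k := ⟨0, ∅, ⟨by simp, by simp⟩, rfl⟩
  have hbd : ∀ k, (∃ s, P s ∧ s.card = k) → k ≤ 5 ^ Module.finrank ℝ E := by
    rintro k ⟨s, hs, rfl⟩; exact hcard s hs
  obtain ⟨N, hN, hNk⟩ := Nat.findGreatest_spec (P := fun k => ∃ s, P s ∧ s.card = k)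
    (Nat.zero_le (5 ^ Module.finrank ℝ E)) (⟨∅, ⟨by simp, by simp⟩, rfl⟩)
  have hmax : ∀ s, P s → s.card ≤ N.card := by
    intro s hs
    rw [hNk]
    exact Nat.le_findGreatest (hcard s hs) ⟨s, hs, rfl⟩
  refine ⟨N, hN.1, hcard N hN, ?_⟩
  have hnear : ∀ x, ‖x‖ ≤ 1 → ∃ y ∈ N, ‖x - y‖ ≤ 1 / 2 := by
    intro x hx
    by_contra! hcon
    have hxN : x ∉ N := fun h => by
      have := hcon x h; simp at this; linarith
    have : P (insert x N) := by
      constructor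
      · intro y hy
        rcases Finset.mem_insert.1 hy with rfl | hy
        · exact hx
        · exact hN.1 y hy
      · intro c hc d hd hcd
        rcases Finset.mem_insert.1 hc with rfl | hc' <;> rcases Finset.mem_insert.1 hd with rfl | hd'
        · exact absurd rfl hcd
        · exact (hcon d hd').le
        · rw [norm_sub_rev]; exact (hcon c hc').le
        · exact hN.2 c hc' d hd' hcd
    have := hmax _ this
    rw [Finset.card_insert_of_notMem hxN] at this
    omega
  intro f c hc x hx
  let F : E →L[ℝ] ℝ := LinearMap.toContinuousLinearMap f
  have hF : ∀ z, |f z| ≤ ‖F‖ * ‖z‖ := fun z => F.le_opNorm z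
  have hc0 : 0 ≤ c := by
    obtain ⟨y, hy, -⟩ := hnear 0 (by simp)
    exact (abs_nonneg _).trans (hc y hy)
  have hball : ∀ x, ‖x‖ ≤ 1 → |f x| ≤ c + ‖F‖ / 2 := by
    intro x hx
    obtain ⟨y, hy, hxy⟩ := hnear x hx
    have h1 : f x = f y + f (x - y) := by rw [map_sub]; ring
    have h2 := hF (x - y)
    have h3 := hc y hy
    have h4 : ‖F‖ * ‖x - y‖ ≤ ‖F‖ * (1 / 2) := by gcongr
    rw [h1]
    exact (abs_add_le _ _).trans (by linarith)
  have hop : ‖F‖ ≤ c + ‖F‖ / 2 := by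
    refine F.opNorm_le_bound (by positivity) fun z => ?_
    by_cases hz : z = 0
    · simp [hz]
    have hz' : 0 < ‖z‖ := norm_pos_iff.2 hz
    have := hball (‖z‖⁻¹ • z) (by rw [norm_smul]; simp [hz'.ne'])
    rw [map_smul, smul_eq_mul, abs_mul, abs_of_pos (inv_pos.2 hz'), inv_mul_le_iff₀ hz'] at this
    rw [mul_comm]; exact this
  have := hball x hx
  linarith

open scoped Matrix.Norms.L2Operator in
theorem exists_matNet (n r : ℕ) : ∃ N : Finset (Matrix (Fin n) (Fin r) ℝ),
    (∀ y ∈ N, Ctr y) ∧ N.card ≤ 5 ^ (n * r) ∧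
      ∀ (f : Matrix (Fin n) (Fin r) ℝ →ₗ[ℝ] ℝ) (c : ℝ),
        (∀ y ∈ N, |f y| ≤ c) → ∀ x, Ctr x → |f x| ≤ 2 * c := by
  obtain ⟨N, h1, h2, h3⟩ := exists_net (Matrix (Fin n) (Fin r) ℝ)
  refine ⟨N, fun y hy => ctr_iff_norm.2 (h1 y hy), ?_, fun f c h x hx => h3 f c h x (ctr_iff_norm.1 hx)⟩
  rw [Module.finrank_matrix] at h2
  simpa using h2

theorem exists_vecNet (ι : Type*) [Fintype ι] : ∃ N : Finset (ι → ℝ),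
    (∀ y ∈ N, ∑ i, y i ^ 2 ≤ 1) ∧ N.card ≤ 5 ^ (Fintype.card ι) ∧
      ∀ (f : (ι → ℝ) →ₗ[ℝ] ℝ) (c : ℝ),
        (∀ y ∈ N, |f y| ≤ c) → ∀ x, ∑ i, x i ^ 2 ≤ 1 → |f x| ≤ 2 * c := by
  classical
  obtain ⟨N, h1, h2, h3⟩ := exists_net (EuclideanSpace ℝ ι)
  have hn : ∀ y : EuclideanSpace ℝ ι, ‖y‖ ≤ 1 ↔ ∑ i, y.ofLp i ^ 2 ≤ 1 := by
    intro y
    rw [EuclideanSpace.norm_eq, Real.sqrt_le_left zero_le_one]; simp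
  refine ⟨N.image WithLp.ofLp, ?_, ?_, ?_⟩
  · intro y hy
    obtain ⟨z, hz, rfl⟩ := Finset.mem_image.1 hy
    exact (hn z).1 (h1 z hz)
  · rw [finrank_euclideanSpace] at h2
    exact Finset.card_image_le.trans h2
  · intro f c h x hx
    exact h3 (f ∘ₗ (WithLp.linearEquiv 2 ℝ (ι → ℝ)).toLinearMap) c
      (fun y hy => h _ (Finset.mem_image_of_mem _ hy)) (WithLp.toLp 2 x) ((hn _).2 hx)

theorem sign_mgf {P : Type*} [Fintype P] [DecidableEq P] (w : P → ℝ) :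
    ∑ g : P → Bool, Real.exp (∑ p, (if g p then (1 : ℝ) else -1) * w p) ≤
      2 ^ Fintype.card P * Real.exp ((∑ p, w p ^ 2) / 2) := by
  have h1 : ∑ g : P → Bool, Real.exp (∑ p, (if g p then (1 : ℝ) else -1) * w p)
      = ∏ p : P, ∑ b : Bool, Real.exp ((if b then (1 : ℝ) else -1) * w p) := by
    rw [Finset.prod_univ_sum, Fintype.piFinset_univ]
    simp only [Real.exp_sum]
  rw [h1, Finset.sum_div, Real.exp_sum, ← Finset.card_univ, ← Finset.prod_const,
    ← Finset.prod_mul_distrib]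
  refine Finset.prod_le_prod (fun p _ => Finset.sum_nonneg fun b _ => (Real.exp_pos _).le) fun p _ => ?_
  have := Real.cosh_le_exp_half_sq (w p)
  rw [Real.cosh_eq] at this
  simp
  linarith

theorem exists_sign {P I : Type*} [Fintype P] [DecidableEq P] [Fintype I]
    (D : I → ℕ) (σ : I → ℝ) (hσ : ∀ i, 0 < σ i) (W : I → Finset (P → ℝ))
    (hcard : ∀ i, (W i).card ≤ 5 ^ D i)
    (hvar : ∀ i, ∀ w ∈ W i, ∑ p, w p ^ 2 ≤ σ i)
    (hsum : ∑ i, 2 * Real.exp (-(D i : ℝ)) < 1) :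
    ∃ g : P → ℝ, (∀ p, g p = 1 ∨ g p = -1) ∧
      ∀ i, ∀ w ∈ W i, (∑ p, g p * w p) ^ 2 ≤ 6 * D i * σ i := by
  by_contra! hcon
  let s : Bool → ℝ := fun b => if b then (1 : ℝ) else -1
  have hs : ∀ b, s b = 1 ∨ s b = -1 := by intro b; cases b <;> simp [s]
  let lam : I → ℝ := fun i => Real.sqrt (6 * D i / σ i)
  have hlam : ∀ i, lam i ^ 2 = 6 * D i / σ i := fun i => Real.sq_sqrt (by have := hσ i; positivity)
  have hge : ∀ g : P → Bool, 1 ≤ ∑ i, ∑ w ∈ W i, Real.exp (-(6 * D i)) *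
      (Real.exp (∑ p, s (g p) * (lam i * w p)) + Real.exp (∑ p, s (g p) * (-lam i * w p))) := by
    intro g
    obtain ⟨i, w, hw, hlt⟩ := hcon (fun p => s (g p)) (fun p => hs _)
    have hnn : ∀ i, ∀ w ∈ W i, 0 ≤ Real.exp (-(6 * D i)) *
      (Real.exp (∑ p, s (g p) * (lam i * w p)) + Real.exp (∑ p, s (g p) * (-lam i * w p))) :=
      fun i w _ => by positivity
    refine le_trans ?_ (Finset.single_le_sum (fun i _ => Finset.sum_nonneg (hnn i)) (Finset.mem_univ i))
    refine le_trans ?_ (Finset.single_le_sum (hnn i) hw)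
    set X := ∑ p, s (g p) * w p with hX
    have e1 : ∑ p, s (g p) * (lam i * w p) = lam i * X := by
      rw [hX, Finset.mul_sum]; exact Finset.sum_congr rfl fun p _ => by ring
    have e2 : ∑ p, s (g p) * (-lam i * w p) = -(lam i * X) := by
      rw [hX, Finset.mul_sum, ← Finset.sum_neg_distrib]; exact Finset.sum_congr rfl fun p _ => by ring
    rw [e1, e2, mul_add, ← Real.exp_add, ← Real.exp_add]
    have hsq : (6 * (D i : ℝ)) ^ 2 ≤ (lam i * X) ^ 2 := by
      rw [mul_pow (lam i) X, hlam]
      have h6 : (6 * (D i : ℝ)) ^ 2 = 6 * D i / σ i * (6 * D i * σ i) := by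
        field_simp [(hσ i).ne']
      rw [h6]
      have := hσ i
      gcongr
    have : 6 * (D i : ℝ) ≤ |lam i * X| := by
      have := sq_le_sq.1 hsq
      rwa [abs_of_nonneg (by positivity)] at this
    rcases le_abs.1 this with h | h
    · have : 1 ≤ Real.exp (-(6 * D i) + lam i * X) := Real.one_le_exp (by linarith)
      have := Real.exp_pos (-(6 * D i) + -(lam i * X))
      linarith
    · have : 1 ≤ Real.exp (-(6 * D i) + -(lam i * X)) := Real.one_le_exp (by linarith)
      have := Real.exp_pos (-(6 * D i) + (lam i * X))
      linarith
  have htot := Finset.sum_le_sum fun g (_ : g ∈ (Finset.univ : Finset (P → Bool))) => hge g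
  rw [Finset.sum_comm] at htot
  have hI : ∀ i, ∑ g : P → Bool, ∑ w ∈ W i, Real.exp (-(6 * D i)) *
      (Real.exp (∑ p, s (g p) * (lam i * w p)) + Real.exp (∑ p, s (g p) * (-lam i * w p)))
      ≤ 2 ^ Fintype.card P * (2 * Real.exp (-(D i : ℝ))) := by
    intro i
    rw [Finset.sum_comm]
    have hw : ∀ w ∈ W i, ∑ g : P → Bool, Real.exp (-(6 * D i)) *
      (Real.exp (∑ p, s (g p) * (lam i * w p)) + Real.exp (∑ p, s (g p) * (-lam i * w p)))
        ≤ 2 ^ Fintype.card P * (2 * Real.exp (-(3 * D i : ℝ))) := by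
      intro w hw
      rw [← Finset.mul_sum, Finset.sum_add_distrib]
      have b1 := sign_mgf (fun p => lam i * w p)
      have b2 := sign_mgf (fun p => -lam i * w p)
      have hv : (∑ p, w p ^ 2) ≤ σ i := hvar i w hw
      have hexp : lam i ^ 2 * (∑ p, w p ^ 2) / 2 ≤ 3 * D i := by
        have : lam i ^ 2 * (∑ p, w p ^ 2) ≤ lam i ^ 2 * σ i := by gcongr
        rw [hlam, div_mul_cancel₀ _ (hσ i).ne', ← hlam] at this
        linarith
      simp only [mul_pow, neg_sq, ← Finset.mul_sum] at b1 b2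
      have hb : Real.exp (lam i ^ 2 * (∑ p, w p ^ 2) / 2) ≤ Real.exp (3 * D i) := Real.exp_le_exp.2 hexp
      have e3 : Real.exp (-(3 * D i : ℝ)) = Real.exp (-(6 * D i)) * Real.exp (3 * D i) := by
        rw [← Real.exp_add]; congr 1; ring
      rw [e3]
      have : (∑ g : P → Bool, Real.exp (∑ p, s (g p) * (lam i * w p)) +
         ∑ g : P → Bool, Real.exp (∑ p, s (g p) * (-lam i * w p))) ≤
          2 ^ Fintype.card P * Real.exp (3 * D i) * 2 := by
        have hh : (2:ℝ) ^ Fintype.card P * Real.exp (lam i ^ 2 * (∑ p, w p ^ 2) / 2) ≤ 2 ^ Fintype.card P * Real.exp (3 * D i) := by gcongr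
        have := add_le_add (b1.trans hh) (b2.trans hh)
        refine le_trans (le_of_eq ?_) (this.trans (by linarith))
        rfl
      calc _ ≤ Real.exp (-(6 * D i)) * (2 ^ Fintype.card P * Real.exp (3 * D i) * 2) := by gcongr
        _ = _ := by ring
    refine (Finset.sum_le_sum hw).trans ?_
    rw [Finset.sum_const, nsmul_eq_mul]
    have hc : ((W i).card : ℝ) ≤ 5 ^ D i := by exact_mod_cast hcard i
    have h5 : (5 : ℝ) ^ D i ≤ Real.exp (2 * D i) := by
      have : (5 : ℝ) ≤ Real.exp 2 := by
        have := Real.exp_one_gt_d9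
        have e : Real.exp 2 = Real.exp 1 * Real.exp 1 := by rw [← Real.exp_add]; norm_num
        rw [e]; nlinarith
      rw [mul_comm, Real.exp_nat_mul]
      gcongr
    have e4 : Real.exp (-(D i : ℝ)) = Real.exp (2 * D i) * Real.exp (-(3 * D i)) := by
      rw [← Real.exp_add]; congr 1; ring
    rw [e4]
    calc ((W i).card : ℝ) * (2 ^ Fintype.card P * (2 * Real.exp (-(3 * D i : ℝ))))
        ≤ Real.exp (2 * D i) * (2 ^ Fintype.card P * (2 * Real.exp (-(3 * D i : ℝ)))) := by
          gcongr; exact hc.trans h5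
      _ = _ := by ring
  have h2 := Finset.sum_le_sum fun i (_ : i ∈ (Finset.univ : Finset I)) => hI i
  rw [← Finset.mul_sum] at h2
  have h3 : ∑ g : P → Bool, (1 : ℝ) = 2 ^ Fintype.card P := by simp
  rw [h3] at htot
  have h4 : (2 : ℝ) ^ Fintype.card P * ∑ i, 2 * Real.exp (-(D i : ℝ)) < 2 ^ Fintype.card P * 1 := by
    gcongr
  linarith

set_option linter.unusedSimpArgs false

/-- triple Kronecker product -/
def kr {a a' b b' c c' : Type*} (A : Matrix a a' ℝ) (B : Matrix b b' ℝ) (C : Matrix c c' ℝ) :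
    Matrix (a × b × c) (a' × b' × c') ℝ := A ⊗ₖ (B ⊗ₖ C)

/-- half-net for contractions -/
def IsNet {n r : ℕ} (N : Finset (Matrix (Fin n) (Fin r) ℝ)) : Prop :=
  (∀ y ∈ N, Ctr y) ∧ N.card ≤ 5 ^ (n * r) ∧
      ∀ (f : Matrix (Fin n) (Fin r) ℝ → ℝ), (∀ x y, f (x + y) = f x + f y) →
        (∀ (a : ℝ) x, f (a • x) = a * f x) → ∀ (c : ℝ),
        (∀ y ∈ N, |f y| ≤ c) → ∀ x, Ctr x → |f x| ≤ 2 * c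

theorem exists_isNet (n r : ℕ) : ∃ N : Finset (Matrix (Fin n) (Fin r) ℝ), IsNet N := by
  obtain ⟨N, h1, h2, h3⟩ := exists_matNet n r
  exact ⟨N, h1, h2, fun f ha hs => h3 ⟨⟨f, ha⟩, by simpa using hs⟩⟩

theorem hsum_aux (κ : ℕ) (D : Fin (κ + 1) × Fin (κ + 1) × Fin (κ + 1) → ℕ)
    (hD : ∀ i, 3 * 2 ^ κ ≤ D i) : ∑ i, 2 * Real.exp (-(D i : ℝ)) < 1 := by
  have h1 : ∀ i, 2 * Real.exp (-(D i : ℝ)) ≤ 2 * Real.exp (-((2 : ℝ) ^ κ)) ^ 3 := by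
    intro i
    have : (3 * 2 ^ κ : ℝ) ≤ D i := by exact_mod_cast hD i
    rw [← Real.exp_nat_mul]
    gcongr
    push_cast; linarith
  refine (Finset.sum_le_sum fun i _ => h1 i).trans_lt ?_
  rw [Finset.sum_const, Finset.card_univ]
  simp only [Fintype.card_prod, Fintype.card_fin, nsmul_eq_mul]
  have h2 : ((κ + 1 : ℕ) : ℝ) ≤ Real.exp (2 ^ κ - 1) := by
    have h3 : ((κ + 1 : ℕ) : ℝ) ≤ 2 ^ κ := by exact_mod_cast Nat.lt_two_pow_self (n := κ)
    have := Real.add_one_le_exp ((2 : ℝ) ^ κ - 1)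
    linarith
  have h4 : ((κ + 1 : ℕ) : ℝ) * Real.exp (-((2 : ℝ) ^ κ)) ≤ Real.exp (-1) := by
    calc _ ≤ Real.exp (2 ^ κ - 1) * Real.exp (-((2 : ℝ) ^ κ)) := by gcongr
      _ = _ := by rw [← Real.exp_add]; congr 1; ring
  have h5 : (((κ + 1 : ℕ) : ℝ) * Real.exp (-((2 : ℝ) ^ κ))) ^ 3 ≤ Real.exp (-1) ^ 3 := by
    gcongr
  have h6 : Real.exp (-1) ≤ 1 / 2 := by
    rw [Real.exp_neg, one_div]
    gcongr
    have := Real.exp_one_gt_d9; linarith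
  have h7 : Real.exp (-1) ^ 3 ≤ (1 / 2) ^ 3 := by gcongr
  calc _ = 2 * (((κ + 1 : ℕ) : ℝ) * Real.exp (-((2 : ℝ) ^ κ))) ^ 3 := by push_cast; ring
    _ < 1 := by linarith

/-- exponents -/
def D1 (κ k l m : ℕ) : ℕ := 2 ^ κ * 2 ^ k + 2 ^ κ * 2 ^ l + 2 ^ κ * 2 ^ m + 2 ^ k * (2 ^ l * 2 ^ m)
def D2 (κ k l m : ℕ) : ℕ := 2 * (2 ^ κ * 2 ^ k + 2 ^ κ * 2 ^ l + 2 ^ κ * 2 ^ m)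

theorem D_aux (κ k : ℕ) : 2 ^ κ ≤ 2 ^ κ * 2 ^ k := Nat.le_mul_of_pos_right _ (by positivity)

theorem kr_mul {a a' a'' b b' b'' c c' c'' : Type*} [Fintype a'] [Fintype b'] [Fintype c']
    (A : Matrix a a' ℝ) (B : Matrix b b' ℝ) (C : Matrix c c' ℝ)
    (A' : Matrix a' a'' ℝ) (B' : Matrix b' b'' ℝ) (C' : Matrix c' c'' ℝ) :
    kr (A * A') (B * B') (C * C') = kr A B C * kr A' B' C' := by
  unfold kr; rw [Matrix.mul_kronecker_mul, Matrix.mul_kronecker_mul]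

theorem kr_transpose {a a' b b' c c' : Type*} (A : Matrix a a' ℝ) (B : Matrix b b' ℝ) (C : Matrix c c' ℝ) :
    (kr A B C)ᵀ = kr Aᵀ Bᵀ Cᵀ := by
  ext p q; simp [kr]

theorem kr_ctr {a a' b b' c c' : Type*} [Fintype a] [Fintype b] [Fintype c] [Fintype a'] [Fintype b'] [Fintype c']
    {A : Matrix a a' ℝ} {B : Matrix b b' ℝ} {C : Matrix c c' ℝ} (hA : Ctr A) (hB : Ctr B) (hC : Ctr C) :
    Ctr (kr A B C) := hA.kron (hB.kron hC)

theorem step1 (κ : ℕ) : ∃ g : Fin (2 ^ κ) × Fin (2 ^ κ) × Fin (2 ^ κ) → ℝ,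
    (∀ p, g p = 1 ∨ g p = -1) ∧
    ∀ k l m : Fin (κ + 1), ∀ (V1 : Matrix (Fin (2 ^ κ)) (Fin (2 ^ (k : ℕ))) ℝ)
      (V2 : Matrix (Fin (2 ^ κ)) (Fin (2 ^ (l : ℕ))) ℝ)
      (V3 : Matrix (Fin (2 ^ κ)) (Fin (2 ^ (m : ℕ))) ℝ), Ctr V1 → Ctr V2 → Ctr V3 →
      ∑ p, ((kr V1ᵀ V2ᵀ V3ᵀ *ᵥ g) p) ^ 2 ≤ 1536 * D1 κ k l m := by
  classical
  choose N hN using fun r => exists_isNet (2 ^ κ) r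
  choose Y hY1 hY2 hY3 using fun (i : Fin (κ + 1) × Fin (κ + 1) × Fin (κ + 1)) =>
    exists_vecNet (Fin (2 ^ (i.1 : ℕ)) × Fin (2 ^ (i.2.1 : ℕ)) × Fin (2 ^ (i.2.2 : ℕ)))
  obtain ⟨g, hg, hb⟩ := exists_sign (P := Fin (2 ^ κ) × Fin (2 ^ κ) × Fin (2 ^ κ))
    (fun i : Fin (κ + 1) × Fin (κ + 1) × Fin (κ + 1) => D1 κ i.1 i.2.1 i.2.2)
    (fun _ => 1) (fun _ => one_pos)
    (fun i => (N (2 ^ (i.1 : ℕ)) ×ˢ N (2 ^ (i.2.1 : ℕ)) ×ˢ N (2 ^ (i.2.2 : ℕ)) ×ˢ Y i).image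
      fun q => kr q.1 q.2.1 q.2.2.1 *ᵥ q.2.2.2)
    (by
      intro i
      refine Finset.card_image_le.trans ?_
      rw [Finset.card_product, Finset.card_product, Finset.card_product, D1, pow_add, pow_add, pow_add,
        mul_assoc, mul_assoc]
      have := hY2 i
      simp only [Fintype.card_prod, Fintype.card_fin] at this
      gcongr
      · exact (hN _).2.1
      · exact (hN _).2.1
      · exact (hN _).2.1)
    (by
      intro i w hw
      obtain ⟨q, hq, rfl⟩ := Finset.mem_image.1 hw
      simp only [Finset.mem_product] at hq
      exact ((kr_ctr ((hN _).1 _ hq.1) ((hN _).1 _ hq.2.1) ((hN _).1 _ hq.2.2.1)).sq _).trans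
        (hY1 i _ hq.2.2.2))
    (hsum_aux κ _ (by
      intro i
      have h1 := D_aux κ i.1
      have h2 := D_aux κ i.2.1
      have h3 := D_aux κ i.2.2
      simp only [D1]
      omega))
  refine ⟨g, hg, fun k l m V1 V2 V3 h1 h2 h3 => ?_⟩
  set c := Real.sqrt (6 * D1 κ k l m) with hc
  have b0 : ∀ v1 ∈ N (2 ^ (k : ℕ)), ∀ v2 ∈ N (2 ^ (l : ℕ)), ∀ v3 ∈ N (2 ^ (m : ℕ)),
      ∀ y ∈ Y (k, l, m), |g ⬝ᵥ (kr v1 v2 v3 *ᵥ y)| ≤ c := by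
    intro v1 hv1 v2 hv2 v3 hv3 y hy
    have := hb (k, l, m) (kr v1 v2 v3 *ᵥ y) (Finset.mem_image.2 ⟨(v1, v2, v3, y), by
      simp only [Finset.mem_product]; exact ⟨hv1, hv2, hv3, hy⟩, rfl⟩)
    rw [mul_one] at this
    exact Real.abs_le_sqrt this
  have b1 : ∀ v1 ∈ N (2 ^ (k : ℕ)), ∀ v2 ∈ N (2 ^ (l : ℕ)), ∀ v3 ∈ N (2 ^ (m : ℕ)),
      ∀ y, ∑ i, y i ^ 2 ≤ 1 → |g ⬝ᵥ (kr v1 v2 v3 *ᵥ y)| ≤ 2 * c := by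
    intro v1 hv1 v2 hv2 v3 hv3
    exact hY3 (k, l, m) ⟨⟨fun y => g ⬝ᵥ (kr v1 v2 v3 *ᵥ y), by simp [mulVec_add]⟩,
      by simp [mulVec_smul]⟩ c (b0 v1 hv1 v2 hv2 v3 hv3)
  have b2 : ∀ v1 ∈ N (2 ^ (k : ℕ)), ∀ v2 ∈ N (2 ^ (l : ℕ)), 
      ∀ y, ∑ i, y i ^ 2 ≤ 1 → |g ⬝ᵥ (kr v1 v2 V3 *ᵥ y)| ≤ 2 * (2 * c) := by
    intro v1 hv1 v2 hv2 y hy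
    exact (hN _).2.2 (fun v => g ⬝ᵥ (kr v1 v2 v *ᵥ y))
      (by simp [kr, kronecker_add, add_mulVec]) (by simp [kr, kronecker_smul, smul_mulVec])
      _ (fun v hv => b1 v1 hv1 v2 hv2 v hv y hy) _ h3
  have b3 : ∀ v1 ∈ N (2 ^ (k : ℕ)),
      ∀ y, ∑ i, y i ^ 2 ≤ 1 → |g ⬝ᵥ (kr v1 V2 V3 *ᵥ y)| ≤ 2 * (2 * (2 * c)) := by
    intro v1 hv1 y hy
    exact (hN _).2.2 (fun v => g ⬝ᵥ (kr v1 v V3 *ᵥ y))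
      (by simp [kr, kronecker_add, add_kronecker, add_mulVec])
      (by simp [kr, kronecker_smul, smul_kronecker, smul_mulVec])
      _ (fun v hv => b2 v1 hv1 v hv y hy) _ h2
  have b4 : ∀ y, ∑ i, y i ^ 2 ≤ 1 → |g ⬝ᵥ (kr V1 V2 V3 *ᵥ y)| ≤ 2 * (2 * (2 * (2 * c))) := by
    intro y hy
    exact (hN _).2.2 (fun v => g ⬝ᵥ (kr v V2 V3 *ᵥ y))
      (by simp [kr, kronecker_add, add_kronecker, add_mulVec])
      (by simp [kr, kronecker_smul, smul_kronecker, smul_mulVec])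
      _ (fun v hv => b3 v hv y hy) _ h1
  set z := kr V1ᵀ V2ᵀ V3ᵀ *ᵥ g with hz
  have hzg : ∀ y, g ⬝ᵥ (kr V1 V2 V3 *ᵥ y) = z ⬝ᵥ y := by
    intro y
    rw [hz, ← kr_transpose, Matrix.dotProduct_mulVec, Matrix.mulVec_transpose]
  set S := ∑ p, z p ^ 2 with hS
  have hS0 : 0 ≤ S := Finset.sum_nonneg fun _ _ => sq_nonneg _
  rcases hS0.eq_or_lt with h0 | hpos
  · rw [← h0]; positivity
  have h16 : (Real.sqrt S) ≤ 16 * c := by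
    have := b4 ((Real.sqrt S)⁻¹ • z) (by
      simp only [Pi.smul_apply, smul_eq_mul, mul_pow, ← Finset.mul_sum]
      rw [inv_pow, Real.sq_sqrt hS0, ← hS, inv_mul_cancel₀ hpos.ne'])
    rw [hzg, dotProduct_smul, smul_eq_mul] at this
    have e : z ⬝ᵥ z = S := by simp [dotProduct, hS, sq]
    rw [e] at this
    have e2 : (Real.sqrt S)⁻¹ * S = Real.sqrt S := by
      rw [inv_mul_eq_div, Real.div_sqrt]
    rw [e2, abs_of_nonneg (Real.sqrt_nonneg _)] at this
    linarith
  have hc2 : c ^ 2 = 6 * D1 κ k l m := Real.sq_sqrt (by positivity)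
  calc S = Real.sqrt S ^ 2 := (Real.sq_sqrt hS0).symm
    _ ≤ (16 * c) ^ 2 := by gcongr
    _ = 1536 * D1 κ k l m := by rw [mul_pow, hc2]; ring

theorem step2 (κ : ℕ) (g' : Fin (2 ^ κ) × Fin (2 ^ κ) × Fin (2 ^ κ) → ℝ)
    (hg' : ∀ k l m : Fin (κ + 1), ∀ (V1 : Matrix (Fin (2 ^ κ)) (Fin (2 ^ (k : ℕ))) ℝ)
      (V2 : Matrix (Fin (2 ^ κ)) (Fin (2 ^ (l : ℕ))) ℝ)
      (V3 : Matrix (Fin (2 ^ κ)) (Fin (2 ^ (m : ℕ))) ℝ), Ctr V1 → Ctr V2 → Ctr V3 →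
      ∑ p, ((kr V1ᵀ V2ᵀ V3ᵀ *ᵥ g') p) ^ 2 ≤ 1536 * D1 κ k l m) :
    ∃ g : Fin (2 ^ κ) × Fin (2 ^ κ) × Fin (2 ^ κ) → ℝ,
    (∀ p, g p = 1 ∨ g p = -1) ∧
    ∀ k l m : Fin (κ + 1), ∀ (U1 V1 : Matrix (Fin (2 ^ κ)) (Fin (2 ^ (k : ℕ))) ℝ)
      (U2 V2 : Matrix (Fin (2 ^ κ)) (Fin (2 ^ (l : ℕ))) ℝ)
      (U3 V3 : Matrix (Fin (2 ^ κ)) (Fin (2 ^ (m : ℕ))) ℝ), Ctr U1 → Ctr U2 → Ctr U3 →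
      Ctr V1 → Ctr V2 → Ctr V3 →
      |g ⬝ᵥ (kr (U1 * V1ᵀ) (U2 * V2ᵀ) (U3 * V3ᵀ) *ᵥ g')| ≤
        64 * Real.sqrt (6 * D2 κ k l m * (1536 * D1 κ k l m)) := by
  classical
  choose N hN using fun r => exists_isNet (2 ^ κ) r
  obtain ⟨g, hg, hb⟩ := exists_sign (P := Fin (2 ^ κ) × Fin (2 ^ κ) × Fin (2 ^ κ))
    (fun i : Fin (κ + 1) × Fin (κ + 1) × Fin (κ + 1) => D2 κ i.1 i.2.1 i.2.2)
    (fun i => 1536 * D1 κ i.1 i.2.1 i.2.2) (fun i => by unfold D1; positivity)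
    (fun i => ((N (2 ^ (i.1 : ℕ)) ×ˢ N (2 ^ (i.2.1 : ℕ)) ×ˢ N (2 ^ (i.2.2 : ℕ))) ×ˢ
        (N (2 ^ (i.1 : ℕ)) ×ˢ N (2 ^ (i.2.1 : ℕ)) ×ˢ N (2 ^ (i.2.2 : ℕ)))).image
      fun q => kr (q.1.1 * q.2.1ᵀ) (q.1.2.1 * q.2.2.1ᵀ) (q.1.2.2 * q.2.2.2ᵀ) *ᵥ g')
    (by
      intro i
      refine Finset.card_image_le.trans ?_
      simp only [Finset.card_product]
      rw [D2, two_mul, pow_add]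
      have : (N (2 ^ (i.1 : ℕ))).card * ((N (2 ^ (i.2.1 : ℕ))).card * (N (2 ^ (i.2.2 : ℕ))).card)
          ≤ 5 ^ (2 ^ κ * 2 ^ (i.1 : ℕ) + 2 ^ κ * 2 ^ (i.2.1 : ℕ) + 2 ^ κ * 2 ^ (i.2.2 : ℕ)) := by
        rw [pow_add, pow_add, mul_assoc]
        gcongr
        · exact (hN _).2.1
        · exact (hN _).2.1
        · exact (hN _).2.1
      gcongr)
    (by
      intro i w hw
      obtain ⟨q, hq, rfl⟩ := Finset.mem_image.1 hw
      simp only [Finset.mem_product] at hq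
      obtain ⟨⟨q1, q2, q3⟩, q4, q5, q6⟩ := hq
      rw [kr_mul, ← Matrix.mulVec_mulVec]
      exact ((kr_ctr ((hN _).1 _ q1) ((hN _).1 _ q2) ((hN _).1 _ q3)).sq _).trans
        (hg' i.1 i.2.1 i.2.2 _ _ _ ((hN _).1 _ q4) ((hN _).1 _ q5) ((hN _).1 _ q6)))
    (hsum_aux κ _ (by
      intro i
      have h1 := D_aux κ i.1
      have h2 := D_aux κ i.2.1
      have h3 := D_aux κ i.2.2
      simp only [D2]
      omega))
  refine ⟨g, hg, fun k l m U1 V1 U2 V2 U3 V3 h1 h2 h3 h4 h5 h6 => ?_⟩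
  set c := Real.sqrt (6 * D2 κ k l m * (1536 * D1 κ k l m)) with hc
  have b0 : ∀ u1 ∈ N (2 ^ (k : ℕ)), ∀ u2 ∈ N (2 ^ (l : ℕ)), ∀ u3 ∈ N (2 ^ (m : ℕ)),
      ∀ v1 ∈ N (2 ^ (k : ℕ)), ∀ v2 ∈ N (2 ^ (l : ℕ)), ∀ v3 ∈ N (2 ^ (m : ℕ)),
      |g ⬝ᵥ (kr (u1 * v1ᵀ) (u2 * v2ᵀ) (u3 * v3ᵀ) *ᵥ g')| ≤ c := by
    intro u1 hu1 u2 hu2 u3 hu3 v1 hv1 v2 hv2 v3 hv3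
    have := hb (k, l, m) (kr (u1 * v1ᵀ) (u2 * v2ᵀ) (u3 * v3ᵀ) *ᵥ g') (Finset.mem_image.2
      ⟨((u1, u2, u3), (v1, v2, v3)), by
      simp only [Finset.mem_product]; exact ⟨⟨hu1, hu2, hu3⟩, hv1, hv2, hv3⟩, rfl⟩)
    exact Real.abs_le_sqrt this
  have b1 : ∀ u1 ∈ N (2 ^ (k : ℕ)), ∀ u2 ∈ N (2 ^ (l : ℕ)), ∀ u3 ∈ N (2 ^ (m : ℕ)),
      ∀ v1 ∈ N (2 ^ (k : ℕ)), ∀ v2 ∈ N (2 ^ (l : ℕ)),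
      |g ⬝ᵥ (kr (u1 * v1ᵀ) (u2 * v2ᵀ) (u3 * V3ᵀ) *ᵥ g')| ≤ 2 * c := by
    intro u1 hu1 u2 hu2 u3 hu3 v1 hv1 v2 hv2
    exact (hN _).2.2 (fun v => g ⬝ᵥ (kr (u1 * v1ᵀ) (u2 * v2ᵀ) (u3 * vᵀ) *ᵥ g'))
      (by simp [kr, kronecker_add, add_kronecker, add_mulVec, Matrix.add_mul, Matrix.mul_add])
      (by simp [kr, kronecker_smul, smul_kronecker, smul_mulVec])
      _ (fun v hv => b0 u1 hu1 u2 hu2 u3 hu3 v1 hv1 v2 hv2 v hv) _ h6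
  have b2 : ∀ u1 ∈ N (2 ^ (k : ℕ)), ∀ u2 ∈ N (2 ^ (l : ℕ)), ∀ u3 ∈ N (2 ^ (m : ℕ)),
      ∀ v1 ∈ N (2 ^ (k : ℕ)),
      |g ⬝ᵥ (kr (u1 * v1ᵀ) (u2 * V2ᵀ) (u3 * V3ᵀ) *ᵥ g')| ≤ 2 * (2 * c) := by
    intro u1 hu1 u2 hu2 u3 hu3 v1 hv1
    exact (hN _).2.2 (fun v => g ⬝ᵥ (kr (u1 * v1ᵀ) (u2 * vᵀ) (u3 * V3ᵀ) *ᵥ g'))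
      (by simp [kr, kronecker_add, add_kronecker, add_mulVec, Matrix.add_mul, Matrix.mul_add])
      (by simp [kr, kronecker_smul, smul_kronecker, smul_mulVec])
      _ (fun v hv => b1 u1 hu1 u2 hu2 u3 hu3 v1 hv1 v hv) _ h5
  have b3 : ∀ u1 ∈ N (2 ^ (k : ℕ)), ∀ u2 ∈ N (2 ^ (l : ℕ)), ∀ u3 ∈ N (2 ^ (m : ℕ)),
      |g ⬝ᵥ (kr (u1 * V1ᵀ) (u2 * V2ᵀ) (u3 * V3ᵀ) *ᵥ g')| ≤ 2 * (2 * (2 * c)) := by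
    intro u1 hu1 u2 hu2 u3 hu3
    exact (hN _).2.2 (fun v => g ⬝ᵥ (kr (u1 * vᵀ) (u2 * V2ᵀ) (u3 * V3ᵀ) *ᵥ g'))
      (by simp [kr, kronecker_add, add_kronecker, add_mulVec, Matrix.add_mul, Matrix.mul_add])
      (by simp [kr, kronecker_smul, smul_kronecker, smul_mulVec])
      _ (fun v hv => b2 u1 hu1 u2 hu2 u3 hu3 v hv) _ h4
  have b4 : ∀ u1 ∈ N (2 ^ (k : ℕ)), ∀ u2 ∈ N (2 ^ (l : ℕ)),
      |g ⬝ᵥ (kr (u1 * V1ᵀ) (u2 * V2ᵀ) (U3 * V3ᵀ) *ᵥ g')| ≤ 2 * (2 * (2 * (2 * c))) := by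
    intro u1 hu1 u2 hu2
    exact (hN _).2.2 (fun v => g ⬝ᵥ (kr (u1 * V1ᵀ) (u2 * V2ᵀ) (v * V3ᵀ) *ᵥ g'))
      (by simp [kr, kronecker_add, add_kronecker, add_mulVec, Matrix.add_mul, Matrix.mul_add])
      (by simp [kr, kronecker_smul, smul_kronecker, smul_mulVec])
      _ (fun v hv => b3 u1 hu1 u2 hu2 v hv) _ h3
  have b5 : ∀ u1 ∈ N (2 ^ (k : ℕ)),
      |g ⬝ᵥ (kr (u1 * V1ᵀ) (U2 * V2ᵀ) (U3 * V3ᵀ) *ᵥ g')| ≤ 2 * (2 * (2 * (2 * (2 * c)))) := by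
    intro u1 hu1
    exact (hN _).2.2 (fun v => g ⬝ᵥ (kr (u1 * V1ᵀ) (v * V2ᵀ) (U3 * V3ᵀ) *ᵥ g'))
      (by simp [kr, kronecker_add, add_kronecker, add_mulVec, Matrix.add_mul, Matrix.mul_add])
      (by simp [kr, kronecker_smul, smul_kronecker, smul_mulVec])
      _ (fun v hv => b4 u1 hu1 v hv) _ h2
  have b6 := (hN _).2.2 (fun v => g ⬝ᵥ (kr (v * V1ᵀ) (U2 * V2ᵀ) (U3 * V3ᵀ) *ᵥ g'))
      (by simp [kr, kronecker_add, add_kronecker, add_mulVec, Matrix.add_mul, Matrix.mul_add])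
      (by simp [kr, kronecker_smul, smul_kronecker, smul_mulVec])
      _ (fun v hv => b5 v hv) _ h1

  linarith

theorem exists_proj {n q : ℕ} {Q : Type*} [Fintype Q] (hQ : Fintype.card Q ≤ q)
    (z : Q → Fin n → ℝ) : ∃ V : Matrix (Fin n) (Fin q) ℝ, Ctr V ∧
      ∀ a, (V * Vᵀ) *ᵥ (z a) = z a := by
  classical
  let z' : Q → EuclideanSpace ℝ (Fin n) := fun a => WithLp.toLp 2 (z a)
  let W := Submodule.span ℝ (Set.range z')
  let b := stdOrthonormalBasis ℝ W
  have hd : Module.finrank ℝ W ≤ q := (finrank_range_le_card z').trans hQ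
  let e : Fin (Module.finrank ℝ W) ↪ Fin q := Fin.castLEEmb hd
  let b' : Fin q → EuclideanSpace ℝ (Fin n) := Function.extend e (fun j => (b j : EuclideanSpace ℝ (Fin n))) 0
  have hb' : ∀ j, b' (e j) = b j := fun j => e.injective.extend_apply _ _ j
  have hb0 : ∀ j, (∀ i, e i ≠ j) → b' j = 0 := fun j hj =>
    Function.extend_apply' _ _ _ (by rintro ⟨i, hi⟩; exact hj i hi)
  let V : Matrix (Fin n) (Fin q) ℝ := fun i j => b' j i
  have hin : ∀ x y : EuclideanSpace ℝ (Fin n), ∑ i, x i * y i = inner ℝ x y := by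
    intro x y
    rw [PiLp.inner_apply]; exact Finset.sum_congr rfl fun i _ => by simp [mul_comm]
  refine ⟨V, ctr_of_diag (fun j => if ∃ i, e i = j then 1 else 0) (fun j => by split_ifs <;> norm_num) ?_, ?_⟩
  · ext j j'
    rw [Matrix.mul_apply]
    simp only [Matrix.transpose_apply]
    rw [show ∑ i, V i j * V i j' = inner ℝ (b' j) (b' j') from hin _ _, Matrix.diagonal_apply]
    by_cases hj : ∃ i, e i = j
    · obtain ⟨i, rfl⟩ := hj
      by_cases hj' : ∃ i', e i' = j'
      · obtain ⟨i', rfl⟩ := hj'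
        rw [hb', hb', ← Submodule.coe_inner, orthonormal_iff_ite.1 b.orthonormal]
        simp [e.injective.eq_iff]
      · rw [hb0 j' (fun i hi => hj' ⟨i, hi⟩), inner_zero_right, if_neg]
        rintro rfl; exact hj' ⟨i, rfl⟩
    · rw [hb0 j (fun i hi => hj ⟨i, hi⟩), inner_zero_left, if_neg hj]; simp
  · intro a
    have hmem : z' a ∈ W := Submodule.subset_span ⟨a, rfl⟩
    have h1 := b.sum_repr' ⟨z' a, hmem⟩
    have h2 := congrArg (fun x : W => (x : EuclideanSpace ℝ (Fin n))) h1
    simp only [AddSubmonoidClass.coe_finsetSum, Submodule.coe_smul, Submodule.coe_inner] at h2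
    have h3 : ∑ j : Fin q, inner ℝ (b' j) (z' a) • b' j = z' a := by
      refine Eq.trans ?_ h2
      rw [← Finset.sum_subset (Finset.subset_univ (Finset.univ.map e)), Finset.sum_map]
      · exact Finset.sum_congr rfl fun j _ => by rw [hb']
      · intro j _ hj
        rw [hb0 j (fun i hi => hj (Finset.mem_map.2 ⟨i, Finset.mem_univ _, hi⟩)), smul_zero]
    ext i
    have h4 := congrArg (fun x : EuclideanSpace ℝ (Fin n) => x i) h3
    simp only [WithLp.ofLp_sum, WithLp.ofLp_smul, Finset.sum_apply, Pi.smul_apply, smul_eq_mul] at h4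
    rw [← Matrix.mulVec_mulVec]
    refine Eq.trans ?_ h4
    simp only [Matrix.mulVec, dotProduct]
    refine Finset.sum_congr rfl fun j _ => ?_
    rw [mul_comm, ← hin]; rfl

theorem rank_red {n q : ℕ} {J Q : Type*} [Fintype J] [Fintype Q] [DecidableEq Q]
    (hQ : Fintype.card Q ≤ q)
    (u w : Fin n × J → ℝ) (U V : Matrix J Q ℝ) (c : ℝ)
    (h : ∀ U' V' : Matrix (Fin n) (Fin q) ℝ, Ctr U' → Ctr V' →
      |u ⬝ᵥ (((U' * V'ᵀ) ⊗ₖ (U * Vᵀ)) *ᵥ w)| ≤ c)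
    (A : Matrix (Fin n) (Fin n) ℝ) (hA : Ctr A) : |u ⬝ᵥ ((A ⊗ₖ (U * Vᵀ)) *ᵥ w)| ≤ c := by
  set z := ((1 : Matrix (Fin n) (Fin n) ℝ) ⊗ₖ Vᵀ) *ᵥ w with hz
  obtain ⟨X, hX, hXz⟩ := exists_proj hQ (fun a i => z (i, a))
  have h1 : ((X * Xᵀ) ⊗ₖ (1 : Matrix Q Q ℝ)) *ᵥ z = z := by
    ext ⟨i, a⟩
    have := congrFun (hXz a) i
    refine Eq.trans ?_ this
    simp [Matrix.mulVec, dotProduct, Fintype.sum_prod_type, Matrix.kroneckerMap_apply, Matrix.one_apply]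
  have h2 : ∀ B : Matrix (Fin n) (Fin n) ℝ, (B ⊗ₖ (U * Vᵀ)) *ᵥ w = (B ⊗ₖ U) *ᵥ z := by
    intro B
    rw [hz, Matrix.mulVec_mulVec, ← Matrix.mul_kronecker_mul, Matrix.mul_one]
  have h3 : (A ⊗ₖ (U * Vᵀ)) *ᵥ w = (((A * X) * Xᵀ) ⊗ₖ (U * Vᵀ)) *ᵥ w := by
    rw [h2, h2]
    conv_lhs => rw [← h1]
    rw [Matrix.mulVec_mulVec, ← Matrix.mul_kronecker_mul, Matrix.mul_one, Matrix.mul_assoc]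
  rw [h3]
  exact h _ _ (hA.mul hX) hX

theorem form_equiv {I J : Type*} [Fintype I] [Fintype J] (σ : J ≃ I) (u w : I → ℝ) (M : Matrix I I ℝ) :
    u ⬝ᵥ (M *ᵥ w) = (u ∘ σ) ⬝ᵥ ((M.submatrix σ σ) *ᵥ (w ∘ σ)) := by
  simp only [dotProduct, Matrix.mulVec, Function.comp, Matrix.submatrix_apply]
  rw [← σ.sum_comp]
  refine Finset.sum_congr rfl fun j _ => ?_
  rw [← σ.sum_comp]

def sw2 (a b c : Type*) : (b × a × c) ≃ (a × b × c) where
  toFun p := (p.2.1, p.1, p.2.2)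
  invFun p := (p.2.1, p.1, p.2.2)
  left_inv _ := rfl
  right_inv _ := rfl

def sw3 (a b c : Type*) : (c × a × b) ≃ (a × b × c) where
  toFun p := (p.2.1, p.2.2, p.1)
  invFun p := (p.2.2, p.1, p.2.1)
  left_inv _ := rfl
  right_inv _ := rfl

theorem form_sw2 {n : ℕ} (g g' : Fin n × Fin n × Fin n → ℝ) (A B C : Matrix (Fin n) (Fin n) ℝ) :
    g ⬝ᵥ (kr A B C *ᵥ g') = (g ∘ sw2 _ _ _) ⬝ᵥ (kr B A C *ᵥ (g' ∘ sw2 _ _ _)) := by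
  rw [form_equiv (sw2 _ _ _)]
  congr 2
  ext p q; simp [kr, sw2]; ring

theorem form_sw3 {n : ℕ} (g g' : Fin n × Fin n × Fin n → ℝ) (A B C : Matrix (Fin n) (Fin n) ℝ) :
    g ⬝ᵥ (kr A B C *ᵥ g') = (g ∘ sw3 _ _ _) ⬝ᵥ (kr C A B *ᵥ (g' ∘ sw3 _ _ _)) := by
  rw [form_equiv (sw3 _ _ _)]
  congr 2
  ext p q; simp [kr, sw3]; ring

theorem kr_split {a b c r s t : Type*} [Fintype s] [Fintype t]
    (A : Matrix a r ℝ) (U2 V2 : Matrix b s ℝ) (U3 V3 : Matrix c t ℝ) :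
    kr A (U2 * V2ᵀ) (U3 * V3ᵀ) = A ⊗ₖ ((U2 ⊗ₖ U3) * (V2 ⊗ₖ V3)ᵀ) := by
  unfold kr
  rw [Matrix.mul_kronecker_mul]; rfl

theorem good_arith (κ k l m : ℕ) (hk : k ≤ κ) (hl : l ≤ κ) (hm : m ≤ κ)
    (h1 : k ≤ l + m) (h2 : l ≤ k + m) (h3 : m ≤ k + l) :
    64 * Real.sqrt (6 * D2 κ k l m * (1536 * D1 κ k l m)) ≤
      30144 * (2 ^ κ * Real.sqrt (2 ^ (k + l + m))) := by
  have e : (30144 : ℝ) * (2 ^ κ * Real.sqrt (2 ^ (k + l + m))) =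
      64 * (471 * (2 ^ κ * Real.sqrt (2 ^ (k + l + m)))) := by ring
  rw [e]
  gcongr
  apply Real.sqrt_le_iff.2
  refine ⟨by positivity, ?_⟩
  rw [mul_pow, mul_pow, Real.sq_sqrt (by positivity)]
  simp only [D1, D2]
  push_cast
  have mono : ∀ {a b : ℕ}, a ≤ b → (2 : ℝ) ^ a ≤ 2 ^ b := fun h => pow_le_pow_right₀ (by norm_num) h
  have r1 := mono hk
  have s1 := mono hl
  have t1 := mono hm
  have r2 := mono h1
  have s2 := mono h2
  have t2 := mono h3
  rw [pow_add] at r2 s2 t2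
  rw [pow_add, pow_add]
  have r0 : (0 : ℝ) < 2 ^ k := by positivity
  have s0 : (0 : ℝ) < 2 ^ l := by positivity
  have t0 : (0 : ℝ) < 2 ^ m := by positivity
  have n0 : (0 : ℝ) < 2 ^ κ := by positivity
  generalize (2 : ℝ) ^ k = r at *
  generalize (2 : ℝ) ^ l = s at *
  generalize (2 : ℝ) ^ m = t at *
  generalize (2 : ℝ) ^ κ = n at *
  -- (r+s+t)^2 ≤ 9 r s t
  have q1 : r ^ 2 ≤ r * s * t := by nlinarith
  have q2 : s ^ 2 ≤ r * s * t := by nlinarith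
  have q3 : t ^ 2 ≤ r * s * t := by nlinarith
  have q : (r + s + t) ^ 2 ≤ 9 * (r * s * t) := by
    nlinarith [sq_nonneg (r - s), sq_nonneg (s - t), sq_nonneg (r - t)]
  have p : r + s + t ≤ 3 * n := by linarith
  have hrst : 0 < r * s * t := by positivity
  have a1 : n ^ 2 * (r + s + t) ^ 2 ≤ n ^ 2 * (9 * (r * s * t)) := by gcongr
  have a2 : n * (r + s + t) * (r * s * t) ≤ n * (3 * n) * (r * s * t) := by gcongr
  have a3 : 0 ≤ n ^ 2 * (r * s * t) := by positivity
  calc _ = 18432 * (n ^ 2 * (r + s + t) ^ 2 + n * (r + s + t) * (r * s * t)) := by ring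
    _ ≤ 18432 * (n ^ 2 * (9 * (r * s * t)) + n * (3 * n) * (r * s * t)) := by gcongr
    _ = 221184 * (n ^ 2 * (r * s * t)) := by ring
    _ ≤ 221841 * (n ^ 2 * (r * s * t)) := by gcongr; norm_num
    _ = _ := by ring

theorem step3 (κ : ℕ) : ∃ g g' : Fin (2 ^ κ) × Fin (2 ^ κ) × Fin (2 ^ κ) → ℝ,
    (∀ p, g p = 1 ∨ g p = -1) ∧ (∀ p, g' p = 1 ∨ g' p = -1) ∧
    ∀ k l m : ℕ, k ≤ κ → l ≤ κ → m ≤ κ → ∀ (U1 V1 : Matrix (Fin (2 ^ κ)) (Fin (2 ^ k)) ℝ)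
      (U2 V2 : Matrix (Fin (2 ^ κ)) (Fin (2 ^ l)) ℝ)
      (U3 V3 : Matrix (Fin (2 ^ κ)) (Fin (2 ^ m)) ℝ), Ctr U1 → Ctr V1 → Ctr U2 → Ctr V2 →
      Ctr U3 → Ctr V3 →
      |g ⬝ᵥ (kr (U1 * V1ᵀ) (U2 * V2ᵀ) (U3 * V3ᵀ) *ᵥ g')| ≤
        30144 * (2 ^ κ * Real.sqrt (2 ^ (k + l + m))) := by
  obtain ⟨g', hg', hv⟩ := step1 κ
  obtain ⟨g, hg, hb⟩ := step2 κ g' hv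
  refine ⟨g, g', hg, hg', ?_⟩
  have good : ∀ k l m : ℕ, k ≤ κ → l ≤ κ → m ≤ κ → k ≤ l + m → l ≤ k + m → m ≤ k + l →
      ∀ (U1 V1 : Matrix (Fin (2 ^ κ)) (Fin (2 ^ k)) ℝ)
      (U2 V2 : Matrix (Fin (2 ^ κ)) (Fin (2 ^ l)) ℝ)
      (U3 V3 : Matrix (Fin (2 ^ κ)) (Fin (2 ^ m)) ℝ), Ctr U1 → Ctr V1 → Ctr U2 → Ctr V2 →
      Ctr U3 → Ctr V3 →
      |g ⬝ᵥ (kr (U1 * V1ᵀ) (U2 * V2ᵀ) (U3 * V3ᵀ) *ᵥ g')| ≤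
        30144 * (2 ^ κ * Real.sqrt (2 ^ (k + l + m))) := by
    intro k l m hk hl hm h1 h2 h3 U1 V1 U2 V2 U3 V3 c1 c2 c3 c4 c5 c6
    exact (hb ⟨k, by omega⟩ ⟨l, by omega⟩ ⟨m, by omega⟩ U1 V1 U2 V2 U3 V3 c1 c3 c5 c2 c4 c6).trans
      (good_arith κ k l m hk hl hm h1 h2 h3)
  have mono : ∀ {a b : ℕ}, a ≤ b → (30144 : ℝ) * (2 ^ κ * Real.sqrt (2 ^ a)) ≤
      30144 * (2 ^ κ * Real.sqrt (2 ^ b)) := by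
    intro a b h
    have : (2 : ℝ) ^ a ≤ 2 ^ b := pow_le_pow_right₀ (by norm_num) h
    gcongr
  intro k l m hk hl hm U1 V1 U2 V2 U3 V3 c1 c2 c3 c4 c5 c6
  by_cases h1 : k ≤ l + m
  · by_cases h2 : l ≤ k + m
    · by_cases h3 : m ≤ k + l
      · exact good k l m hk hl hm h1 h2 h3 U1 V1 U2 V2 U3 V3 c1 c2 c3 c4 c5 c6
      · refine le_trans ?_ (mono (show k + l + (k + l) ≤ k + l + m by omega))
        rw [form_sw3, kr_split]
        refine rank_red (q := 2 ^ (k + l)) (by simp [pow_add]) _ _ _ _ _ ?_ _ (c5.mul c6.transpose)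
        intro U' V' d1 d2
        rw [← kr_split, ← form_sw3]
        exact good k l (k + l) hk hl (by omega) (by omega) (by omega) (by omega) _ _ _ _ _ _ c1 c2 c3 c4 d1 d2
    · refine le_trans ?_ (mono (show k + (k + m) + m ≤ k + l + m by omega))
      rw [form_sw2, kr_split]
      refine rank_red (q := 2 ^ (k + m)) (by simp [pow_add]) _ _ _ _ _ ?_ _ (c3.mul c4.transpose)
      intro U' V' d1 d2
      rw [← kr_split, ← form_sw2]
      exact good k (k + m) m hk (by omega) hm (by omega) (by omega) (by omega) _ _ _ _ _ _ c1 c2 d1 d2 c5 c6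
  · refine le_trans ?_ (mono (show (l + m) + l + m ≤ k + l + m by omega))
    rw [kr_split]
    refine rank_red (q := 2 ^ (l + m)) (by simp [pow_add]) _ _ _ _ _ ?_ _ (c1.mul c2.transpose)
    intro U' V' d1 d2
    rw [← kr_split]
    exact good (l + m) l m (by omega) hl hm (by omega) (by omega) (by omega) _ _ _ _ _ _ d1 d2 c3 c4 c5 c6

theorem spec {n : ℕ} (A : Matrix (Fin n) (Fin n) ℝ) : ∃ (W : Matrix (Fin n) (Fin n) ℝ) (lam : Fin n → ℝ),
    Antitone lam ∧ Wᵀ * W = 1 ∧ W * Wᵀ = 1 ∧ (A * W)ᵀ * (A * W) = diagonal lam := by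
  have hH : (Aᵀ * A).IsHermitian := by
    rw [Matrix.IsHermitian, Matrix.conjTranspose_eq_transpose_of_trivial, Matrix.transpose_mul,
      Matrix.transpose_transpose]
  let W0 : Matrix (Fin n) (Fin n) ℝ := hH.eigenvectorUnitary
  have h1 : W0ᵀ * W0 = 1 := by
    have := Unitary.coe_star_mul_self hH.eigenvectorUnitary
    rwa [Matrix.star_eq_conjTranspose, Matrix.conjTranspose_eq_transpose_of_trivial] at this
  have h2 : W0ᵀ * (Aᵀ * A) * W0 = diagonal hH.eigenvalues := by
    have := hH.conjStarAlgAut_star_eigenvectorUnitary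
    rw [Unitary.conjStarAlgAut_star_apply, Matrix.star_eq_conjTranspose,
      Matrix.conjTranspose_eq_transpose_of_trivial] at this
    exact this
  let σ := Tuple.sort (fun i => - hH.eigenvalues i)
  have hσ : Monotone ((fun i => - hH.eigenvalues i) ∘ σ) := Tuple.monotone_sort _
  have h3 : (W0.submatrix id σ)ᵀ * (W0.submatrix id σ) = 1 := by
    have := congrArg (fun M : Matrix (Fin n) (Fin n) ℝ => M.submatrix σ σ) h1
    simp only [Matrix.submatrix_one_equiv] at this
    rw [← this]; rfl
  refine ⟨W0.submatrix id σ, hH.eigenvalues ∘ σ, ?_, h3, mul_eq_one_comm.1 h3, ?_⟩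
  · intro i j hij
    have := hσ hij
    simp only [Function.comp] at this ⊢
    linarith
  · have := congrArg (fun M : Matrix (Fin n) (Fin n) ℝ => M.submatrix σ σ) h2
    simp only [Matrix.submatrix_diagonal_equiv] at this
    rw [← this, Matrix.mul_assoc, Matrix.mul_assoc]
    rw [Matrix.transpose_mul, Matrix.mul_assoc]
    rfl

theorem dyadic_sum (f : ℕ → ℝ) (K : ℕ) :
    ∑ k ∈ Finset.range K, ∑ a : Fin (2 ^ k), f (2 ^ k - 1 + a) = ∑ t ∈ Finset.range (2 ^ K - 1), f t := by
  induction K with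
  | zero => simp
  | succ K ih =>
    have : 2 ^ (K + 1) - 1 = (2 ^ K - 1) + 2 ^ K := by
      have := Nat.one_le_two_pow (n := K); omega
    rw [Finset.sum_range_succ, ih, this, Finset.sum_range_add, Finset.sum_range (n := 2 ^ K)]

theorem condensed (f : ℕ → ℝ) (hf : Antitone f) (K : ℕ) :
    ∑ k ∈ Finset.range (K + 1), 2 ^ k * f (2 ^ k - 1) ≤ f 0 + 2 * ∑ t ∈ Finset.range (2 ^ K - 1), f t := by
  induction K with
  | zero => simp
  | succ K ih =>
    have : 2 ^ (K + 1) - 1 = (2 ^ K - 1) + 2 ^ K := by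
      have := Nat.one_le_two_pow (n := K); omega
    rw [Finset.sum_range_succ, this, Finset.sum_range_add f (2 ^ K - 1) (2 ^ K)]
    have h : (2 : ℝ) ^ K * f (2 ^ K - 1 + 2 ^ K) ≤ ∑ x ∈ Finset.range (2 ^ K), f (2 ^ K - 1 + x) := by
      have := Finset.card_nsmul_le_sum (Finset.range (2 ^ K)) (fun x => f (2 ^ K - 1 + x))
        (f (2 ^ K - 1 + 2 ^ K)) (fun x hx => hf (by have := Finset.mem_range.1 hx; omega))
      simpa using this
    have e : (2 : ℝ) ^ (K + 1) * f (2 ^ K - 1 + 2 ^ K) = 2 * (2 ^ K * f (2 ^ K - 1 + 2 ^ K)) := by ring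
    rw [e]
    linarith

theorem decomp (κ n : ℕ) (hn : n = 2 ^ κ) (A : Matrix (Fin n) (Fin n) ℝ) :
    ∃ (c : ℕ → ℝ) (U V : ∀ k : ℕ, Matrix (Fin n) (Fin (2 ^ k)) ℝ),
      (∀ k, 0 ≤ c k) ∧ (∀ k, Ctr (U k)) ∧ (∀ k, Ctr (V k)) ∧
      A = ∑ k ∈ Finset.range (κ + 1), c k • (U k * (V k)ᵀ) ∧
      ∑ k ∈ Finset.range (κ + 1), 2 ^ k * c k ^ 2 ≤ 3 * ∑ i, ∑ j, A i j ^ 2 := by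
  obtain ⟨W, lam, hanti, hW1, hW2, hAW⟩ := spec A
  have hlam : ∀ i, 0 ≤ lam i := by
    intro i
    have := congrFun (congrFun hAW i) i
    rw [Matrix.diagonal_apply_eq, Matrix.mul_apply] at this
    rw [← this]
    exact Finset.sum_nonneg fun j _ => by rw [Matrix.transpose_apply]; exact mul_self_nonneg _
  have htr : ∑ i, lam i = ∑ i, ∑ j, A i j ^ 2 := by
    have h := congrArg Matrix.trace hAW
    rw [Matrix.trace_diagonal, Matrix.transpose_mul, Matrix.mul_assoc, Matrix.trace_mul_comm,
      ← Matrix.mul_assoc, Matrix.mul_assoc, hW2, Matrix.mul_one] at h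
    rw [← h, Matrix.trace, Finset.sum_comm]
    refine Finset.sum_congr rfl fun j _ => ?_
    simp [Matrix.mul_apply, sq]
  let L : ℕ → ℝ := fun i => if h : i < n then lam ⟨i, h⟩ else 0
  have hL0 : ∀ i, 0 ≤ L i := fun i => by
    simp only [L]; split_ifs
    · exact hlam _
    · exact le_rfl
  have hLa : Antitone L := by
    intro i j hij
    by_cases hj : j < n
    · have hi : i < n := by omega
      simp only [L, hi, hj, dif_pos]
      exact hanti (show (⟨i, hi⟩ : Fin n) ≤ ⟨j, hj⟩ from hij)
    · have : L j = 0 := by simp [L, hj]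
      rw [this]; exact hL0 i
  let w : ℕ → Fin n → ℝ := fun t i => if h : t < n then W i ⟨t, h⟩ else 0
  let V : ∀ k : ℕ, Matrix (Fin n) (Fin (2 ^ k)) ℝ := fun k => Matrix.of fun i a => w (2 ^ k - 1 + a) i
  have hV : ∀ k i a, V k i a = w (2 ^ k - 1 + a) i := fun _ _ _ => rfl
  have hww : ∀ s t, ∑ i, w s i * w t i = if s = t ∧ s < n then 1 else 0 := by
    intro s t
    by_cases hs : s < n
    · by_cases ht : t < n
      · have := congrFun (congrFun hW1 ⟨s, hs⟩) ⟨t, ht⟩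
        rw [Matrix.mul_apply, Matrix.one_apply] at this
        simpa [w, hs, ht] using this
      · have : ¬ (s = t ∧ s < n) := by omega
        simp [w, ht, this]
    · have : ¬ (s = t ∧ s < n) := by omega
      simp [w, hs]
  have hAA : ∀ s t, ∑ i, (A *ᵥ w s) i * (A *ᵥ w t) i = if s = t then L s else 0 := by
    intro s t
    by_cases hs : s < n
    · by_cases ht : t < n
      · have := congrFun (congrFun hAW ⟨s, hs⟩) ⟨t, ht⟩
        rw [Matrix.mul_apply, Matrix.diagonal_apply] at this
        have hw' : ∀ s (hs : s < n), w s = fun i => W i ⟨s, hs⟩ := by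
          intro s hs; ext i; simp [w, hs]
        rw [hw' s hs, hw' t ht]
        simp only [L, hs, dif_pos]
        simp only [Matrix.transpose_apply, Fin.mk.injEq] at this
        exact this
      · have h0 : w t = 0 := by ext i; simp [w, ht]
        have : s ≠ t := by omega
        simp [h0, this]
    · have h0 : w s = 0 := by ext i; simp [w, hs]
      simp [h0, L, hs]
  have hVV : ∀ k, (V k)ᵀ * V k = diagonal (fun a : Fin (2 ^ k) => if 2 ^ k - 1 + (a : ℕ) < n then 1 else 0) := by
    intro k; ext a b
    rw [Matrix.mul_apply, Matrix.diagonal_apply]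
    simp only [Matrix.transpose_apply, hV]
    rw [hww]
    by_cases hab : a = b
    · subst hab; simp
    · have : ¬ (2 ^ k - 1 + (a : ℕ) = 2 ^ k - 1 + (b : ℕ) ∧ 2 ^ k - 1 + (a : ℕ) < n) := by
        intro h; exact hab (Fin.ext (by omega))
      rw [if_neg this, if_neg hab]
  have hAVAV : ∀ k, (A * V k)ᵀ * (A * V k) = diagonal (fun a : Fin (2 ^ k) => L (2 ^ k - 1 + a)) := by
    intro k; ext a b
    rw [Matrix.mul_apply, Matrix.diagonal_apply]
    have := hAA (2 ^ k - 1 + a) (2 ^ k - 1 + b)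
    refine Eq.trans ?_ (this.trans ?_)
    · rfl
    · by_cases hab : a = b
      · subst hab; simp
      · rw [if_neg hab, if_neg]
        intro h; exact hab (Fin.ext (by omega))
  let c : ℕ → ℝ := fun k => Real.sqrt (L (2 ^ k - 1))
  have hc2 : ∀ k, c k ^ 2 = L (2 ^ k - 1) := fun k => Real.sq_sqrt (hL0 _)
  refine ⟨c, fun k => (c k)⁻¹ • (A * V k), V, fun k => Real.sqrt_nonneg _, ?_, ?_, ?_, ?_⟩
  · intro k
    refine ctr_of_diag (fun a : Fin (2 ^ k) => (c k)⁻¹ * ((c k)⁻¹ * L (2 ^ k - 1 + a))) ?_ ?_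
    · intro a
      have hle : L (2 ^ k - 1 + a) ≤ c k ^ 2 := by rw [hc2]; exact hLa (by omega)
      by_cases h0 : c k = 0
      · simp [h0]
      · have hp : 0 < c k := lt_of_le_of_ne (Real.sqrt_nonneg _) (Ne.symm h0)
        rw [← mul_assoc, ← mul_inv, inv_mul_le_iff₀ (by positivity)]
        linarith [sq (c k)]
    · rw [Matrix.transpose_smul, Matrix.smul_mul, Matrix.mul_smul, hAVAV]
      ext a b
      simp only [Matrix.smul_apply, Matrix.diagonal_apply, smul_eq_mul]
      split_ifs <;> simp
  · intro k
    exact ctr_of_diag _ (fun a => by split_ifs <;> norm_num) (hVV k)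
  · have hk : ∀ k, c k • ((c k)⁻¹ • (A * V k) * (V k)ᵀ) = A * (V k * (V k)ᵀ) := by
      intro k
      rw [Matrix.smul_mul, smul_smul, ← Matrix.mul_assoc]
      by_cases h0 : c k = 0
      · have hz : A * V k = 0 := by
          have h1 : (A * V k)ᵀ * (A * V k) = 0 := by
            rw [hAVAV]
            ext a b
            have : L (2 ^ k - 1 + a) = 0 := le_antisymm (by
              have := hc2 k; rw [h0] at this
              have h2 : L (2 ^ k - 1 + a) ≤ L (2 ^ k - 1) := hLa (by omega)
              rw [← this] at h2; simpa using h2) (hL0 _)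
            simp [Matrix.diagonal_apply, this]
          rw [← Matrix.conjTranspose_eq_transpose_of_trivial] at h1
          exact Matrix.conjTranspose_mul_self_eq_zero.1 h1
        rw [hz]; simp
      · rw [mul_inv_cancel₀ h0, one_smul]
    simp only [hk]
    rw [← Matrix.mul_sum]
    have : ∑ k ∈ Finset.range (κ + 1), V k * (V k)ᵀ = 1 := by
      rw [← hW2]
      ext i j
      rw [Matrix.sum_apply]
      simp only [Matrix.mul_apply, Matrix.transpose_apply, hV]
      rw [dyadic_sum (fun t => w t i * w t j) (κ + 1)]
      have hle : n ≤ 2 ^ (κ + 1) - 1 := by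
        have := Nat.one_le_two_pow (n := κ); rw [pow_succ]; omega
      rw [← Finset.sum_subset (Finset.range_mono hle), Finset.sum_range]
      · refine Finset.sum_congr rfl fun t _ => ?_
        simp [w]
      · intro t _ ht
        have : ¬ t < n := by simpa using ht
        simp [w, this]
    rw [this, Matrix.mul_one]
  · simp only [hc2]
    refine (condensed L hLa κ).trans ?_
    have hs : ∑ t ∈ Finset.range n, L t = ∑ i, ∑ j, A i j ^ 2 := by
      rw [← htr, Finset.sum_range]
      refine Finset.sum_congr rfl fun t _ => by simp [L]
    have h1 : L 0 ≤ ∑ t ∈ Finset.range n, L t :=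
      Finset.single_le_sum (f := L) (fun i _ => hL0 i) (Finset.mem_range.2 (by rw [hn]; positivity))
    have h2 : ∑ t ∈ Finset.range (2 ^ κ - 1), L t ≤ ∑ t ∈ Finset.range n, L t :=
      Finset.sum_le_sum_of_subset_of_nonneg (Finset.range_mono (by omega)) (fun i _ _ => hL0 i)
    rw [hs] at h1 h2
    linarith

theorem le_sq_aux {a b : ℝ} (h : a ^ 2 ≤ b ^ 2) (hb : 0 ≤ b) : a ≤ b :=
  (abs_le_of_sq_le_sq' h hb).2

theorem decomp_sum (κ : ℕ) (c : ℕ → ℝ) (S : ℝ) (hS : 0 ≤ S)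
    (h : ∑ k ∈ Finset.range (κ + 1), 2 ^ k * c k ^ 2 ≤ 3 * S ^ 2) :
    ∑ k ∈ Finset.range (κ + 1), c k * Real.sqrt (2 ^ k) ≤ 2 * Real.sqrt (κ + 1) * S := by
  have h1 : (∑ k ∈ Finset.range (κ + 1), c k * Real.sqrt (2 ^ k)) ^ 2 ≤
      (κ + 1) * ∑ k ∈ Finset.range (κ + 1), (c k * Real.sqrt (2 ^ k)) ^ 2 := by
    have := sq_sum_le_card_mul_sum_sq (s := Finset.range (κ + 1)) (f := fun k => c k * Real.sqrt (2 ^ k))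
    simpa using this
  have h2 : ∑ k ∈ Finset.range (κ + 1), (c k * Real.sqrt (2 ^ k)) ^ 2 ≤ 3 * S ^ 2 := by
    refine le_trans (le_of_eq ?_) h
    refine Finset.sum_congr rfl fun k _ => ?_
    rw [mul_pow, Real.sq_sqrt (by positivity)]; ring
  refine le_sq_aux ?_ (by positivity)
  rw [mul_pow, mul_pow, Real.sq_sqrt (by positivity)]
  have h3 : ((κ : ℝ) + 1) * ∑ k ∈ Finset.range (κ + 1), (c k * Real.sqrt (2 ^ k)) ^ 2 ≤ (κ + 1) * (3 * S ^ 2) := by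
    gcongr
  have : 0 ≤ ((κ : ℝ) + 1) * S ^ 2 := by positivity
  linarith

theorem step4 (κ : ℕ) : ∃ g g' : Fin (2 ^ κ) × Fin (2 ^ κ) × Fin (2 ^ κ) → ℝ,
    (∀ p, g p = 1 ∨ g p = -1) ∧ (∀ p, g' p = 1 ∨ g' p = -1) ∧
    ∀ (A B C : Matrix (Fin (2 ^ κ)) (Fin (2 ^ κ)) ℝ) (S : ℝ), 0 ≤ S →
      ∑ i, ∑ j, A i j ^ 2 ≤ S ^ 2 → ∑ i, ∑ j, B i j ^ 2 ≤ S ^ 2 → ∑ i, ∑ j, C i j ^ 2 ≤ S ^ 2 →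
      |g ⬝ᵥ (kr A B C *ᵥ g')| ≤ 30144 * 2 ^ κ * (2 * Real.sqrt (κ + 1) * S) ^ 3 := by
  obtain ⟨g, g', hg, hg', hb⟩ := step3 κ
  refine ⟨g, g', hg, hg', ?_⟩
  intro A B C S hS hA hB hC
  obtain ⟨a, U1, V1, a0, u1, v1, eA, sA⟩ := decomp κ _ rfl A
  obtain ⟨b, U2, V2, b0, u2, v2, eB, sB⟩ := decomp κ _ rfl B
  obtain ⟨c, U3, V3, c0, u3, v3, eC, sC⟩ := decomp κ _ rfl C
  have iA := decomp_sum κ a S hS (by linarith)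
  have iB := decomp_sum κ b S hS (by linarith)
  have iC := decomp_sum κ c S hS (by linarith)
  have key : g ⬝ᵥ (kr A B C *ᵥ g') = ∑ k ∈ Finset.range (κ + 1), ∑ l ∈ Finset.range (κ + 1),
      ∑ m ∈ Finset.range (κ + 1), a k * b l * c m *
        (g ⬝ᵥ (kr (U1 k * (V1 k)ᵀ) (U2 l * (V2 l)ᵀ) (U3 m * (V3 m)ᵀ) *ᵥ g')) := by
    have l1 : ∀ (B C : Matrix (Fin (2 ^ κ)) (Fin (2 ^ κ)) ℝ) (M : ℕ → Matrix (Fin (2 ^ κ)) (Fin (2 ^ κ)) ℝ),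
      g ⬝ᵥ (kr (∑ k ∈ Finset.range (κ + 1), a k • M k) B C *ᵥ g') =
        ∑ k ∈ Finset.range (κ + 1), a k * (g ⬝ᵥ (kr (M k) B C *ᵥ g')) := by
      intro B C M
      let f : Matrix (Fin (2 ^ κ)) (Fin (2 ^ κ)) ℝ →ₗ[ℝ] ℝ :=
        ⟨⟨fun X => g ⬝ᵥ (kr X B C *ᵥ g'), by simp [kr, add_kronecker, add_mulVec]⟩,
          by simp [kr, smul_kronecker, smul_mulVec]⟩
      have : f (∑ k ∈ Finset.range (κ + 1), a k • M k) = ∑ k ∈ Finset.range (κ + 1), a k * f (M k) := by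
        simp [map_sum]
      exact this
    have l2 : ∀ (A C : Matrix (Fin (2 ^ κ)) (Fin (2 ^ κ)) ℝ) (M : ℕ → Matrix (Fin (2 ^ κ)) (Fin (2 ^ κ)) ℝ),
      g ⬝ᵥ (kr A (∑ k ∈ Finset.range (κ + 1), b k • M k) C *ᵥ g') =
        ∑ k ∈ Finset.range (κ + 1), b k * (g ⬝ᵥ (kr A (M k) C *ᵥ g')) := by
      intro A C M
      let f : Matrix (Fin (2 ^ κ)) (Fin (2 ^ κ)) ℝ →ₗ[ℝ] ℝ :=
        ⟨⟨fun X => g ⬝ᵥ (kr A X C *ᵥ g'), by simp [kr, add_kronecker, kronecker_add, add_mulVec]⟩,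
          by simp [kr, smul_kronecker, kronecker_smul, smul_mulVec]⟩
      have : f (∑ k ∈ Finset.range (κ + 1), b k • M k) = ∑ k ∈ Finset.range (κ + 1), b k * f (M k) := by
        simp [map_sum]
      exact this
    have l3 : ∀ (A B : Matrix (Fin (2 ^ κ)) (Fin (2 ^ κ)) ℝ) (M : ℕ → Matrix (Fin (2 ^ κ)) (Fin (2 ^ κ)) ℝ),
      g ⬝ᵥ (kr A B (∑ k ∈ Finset.range (κ + 1), c k • M k) *ᵥ g') =
        ∑ k ∈ Finset.range (κ + 1), c k * (g ⬝ᵥ (kr A B (M k) *ᵥ g')) := by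
      intro A B M
      let f : Matrix (Fin (2 ^ κ)) (Fin (2 ^ κ)) ℝ →ₗ[ℝ] ℝ :=
        ⟨⟨fun X => g ⬝ᵥ (kr A B X *ᵥ g'), by simp [kr, kronecker_add, add_mulVec]⟩,
          by simp [kr, kronecker_smul, smul_mulVec]⟩
      have : f (∑ k ∈ Finset.range (κ + 1), c k • M k) = ∑ k ∈ Finset.range (κ + 1), c k * f (M k) := by
        simp [map_sum]
      exact this
    rw [eA, eB, eC, l1]
    simp only [l2, l3, Finset.mul_sum, mul_assoc]
  rw [key]
  calc _ ≤ ∑ k ∈ Finset.range (κ + 1), ∑ l ∈ Finset.range (κ + 1), ∑ m ∈ Finset.range (κ + 1),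
        a k * b l * c m * (30144 * (2 ^ κ * Real.sqrt (2 ^ (k + l + m)))) := by
        refine (Finset.abs_sum_le_sum_abs _ _).trans (Finset.sum_le_sum fun k hk => ?_)
        refine (Finset.abs_sum_le_sum_abs _ _).trans (Finset.sum_le_sum fun l hl => ?_)
        refine (Finset.abs_sum_le_sum_abs _ _).trans (Finset.sum_le_sum fun m hm => ?_)
        have h0 : 0 ≤ a k * b l * c m := mul_nonneg (mul_nonneg (a0 _) (b0 _)) (c0 _)
        rw [abs_mul, abs_of_nonneg h0]
        gcongr
        rw [Finset.mem_range] at hk hl hm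
        exact hb k l m (by omega) (by omega) (by omega) _ _ _ _ _ _ (u1 _) (v1 _) (u2 _) (v2 _) (u3 _) (v3 _)
    _ = 30144 * 2 ^ κ * ((∑ k ∈ Finset.range (κ + 1), a k * Real.sqrt (2 ^ k)) *
        (∑ k ∈ Finset.range (κ + 1), b k * Real.sqrt (2 ^ k)) *
        (∑ k ∈ Finset.range (κ + 1), c k * Real.sqrt (2 ^ k))) := by
        rw [Finset.sum_mul_sum, Finset.sum_mul, Finset.mul_sum]
        refine Finset.sum_congr rfl fun k _ => ?_
        rw [Finset.sum_mul, Finset.mul_sum]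
        refine Finset.sum_congr rfl fun l _ => ?_
        rw [Finset.mul_sum, Finset.mul_sum]
        refine Finset.sum_congr rfl fun m _ => ?_
        rw [pow_add, pow_add, Real.sqrt_mul (by positivity), Real.sqrt_mul (by positivity)]
        ring
    _ ≤ 30144 * 2 ^ κ * (2 * Real.sqrt (κ + 1) * S) ^ 3 := by
        rw [pow_three]
        have p2 : 0 ≤ ∑ k ∈ Finset.range (κ + 1), b k * Real.sqrt (2 ^ k) :=
          Finset.sum_nonneg fun k _ => mul_nonneg (b0 k) (Real.sqrt_nonneg _)
        have p3 : 0 ≤ ∑ k ∈ Finset.range (κ + 1), c k * Real.sqrt (2 ^ k) :=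
          Finset.sum_nonneg fun k _ => mul_nonneg (c0 k) (Real.sqrt_nonneg _)
        rw [← mul_assoc (2 * Real.sqrt (κ + 1) * S)]
        gcongr

theorem hadamard (κ : ℕ) : ∃ H : Fin (2 ^ κ) → Fin (2 ^ κ) → ℝ, (∀ b i, H b i ^ 2 = 1) ∧
    ∀ i j, ∑ b, H b i * H b j = if i = j then (2 : ℝ) ^ κ else 0 := by
  have e : Fin (2 ^ κ) ≃ (Fin κ → Bool) := Fintype.equivOfCardEq (by simp)
  let h : Bool → Bool → ℝ := fun a b => if a && b then -1 else 1
  have hh : ∀ a b, h a b ^ 2 = 1 := by intro a b; cases a <;> cases b <;> simp [h]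
  refine ⟨fun b i => ∏ t, h (e b t) (e i t), ?_, ?_⟩
  · intro b i
    rw [← Finset.prod_pow]
    exact Finset.prod_eq_one fun t _ => hh _ _
  · intro i j
    simp only [← Finset.prod_mul_distrib]
    rw [e.sum_comp (fun b : Fin κ → Bool => ∏ t, h (b t) (e i t) * h (b t) (e j t))]
    have h1 : ∑ b : Fin κ → Bool, ∏ t, h (b t) (e i t) * h (b t) (e j t) =
        ∏ t, ∑ b : Bool, h b (e i t) * h b (e j t) := by
      rw [Finset.prod_univ_sum, Fintype.piFinset_univ]
    rw [h1]
    split_ifs with hij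
    · subst hij
      have : ∀ t, ∑ b : Bool, h b (e i t) * h b (e i t) = 2 := by
        intro t; simp only [← sq, hh]; simp
      simp only [this]; simp
    · have : e i ≠ e j := fun hc => hij (e.injective hc)
      obtain ⟨t, ht⟩ := Function.ne_iff.1 this
      refine Finset.prod_eq_zero (Finset.mem_univ t) ?_
      revert ht
      cases e i t <;> cases e j t <;> simp [h]

theorem pauli (κ N : ℕ) (hN : 2 ^ κ ≤ N) : ∃ P : Fin (N ^ 2) → Matrix (Fin (2 ^ κ)) (Fin (2 ^ κ)) ℝ,
    (∀ x, Ctr (P x)) ∧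
    ∀ i j k l, ∑ x, P x i j * P x k l = if i = k ∧ j = l then (2 : ℝ) ^ κ else 0 := by
  obtain ⟨H, hH1, hH2⟩ := hadamard κ
  have : NeZero (2 ^ κ) := ⟨by positivity⟩
  let Q : Fin (2 ^ κ) × Fin (2 ^ κ) → Matrix (Fin (2 ^ κ)) (Fin (2 ^ κ)) ℝ :=
    fun ab => Matrix.of fun i j => if j = i + ab.1 then H ab.2 i else 0
  have hQ : ∀ a b i j, Q (a, b) i j = if j = i + a then H b i else 0 := fun _ _ _ _ => rfl
  have hQc : ∀ ab, Ctr (Q ab) := by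
    rintro ⟨a, b⟩
    refine ctr_of_sq fun v => ?_
    have : ∀ i, (Q (a, b) *ᵥ v) i = H b i * v (i + a) := by
      intro i
      simp [Matrix.mulVec, dotProduct, hQ]
    simp only [this, mul_pow, hH1, one_mul]
    exact le_of_eq (Equiv.sum_comp (Equiv.addRight a) (fun i => v i ^ 2))
  have hQs : ∀ i j k l, ∑ ab, Q ab i j * Q ab k l = if i = k ∧ j = l then (2 : ℝ) ^ κ else 0 := by
    intro i j k l
    rw [Fintype.sum_prod_type]
    have h1 : ∀ a, ∑ b, Q (a, b) i j * Q (a, b) k l =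
        if j = i + a then (if l = k + a then (if i = k then (2 : ℝ) ^ κ else 0) else 0) else 0 := by
      intro a
      simp only [hQ]
      by_cases h : j = i + a <;> by_cases h' : l = k + a <;> simp [h, h', hH2]
    simp only [h1]
    by_cases hik : i = k
    · subst hik
      have h2 : ∀ a, (j = i + a) ↔ (a = j - i) := by
        intro a
        rw [eq_sub_iff_add_eq, add_comm, eq_comm]
      simp only [h2, Finset.sum_ite_eq', Finset.mem_univ, if_true]
      simp [eq_comm]
    · simp [hik]
  have hcard : Fintype.card (Fin (2 ^ κ) × Fin (2 ^ κ)) ≤ Fintype.card (Fin (N ^ 2)) := by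
    simp only [Fintype.card_prod, Fintype.card_fin, sq]
    exact Nat.mul_le_mul hN hN
  obtain ⟨ι⟩ := Function.Embedding.nonempty_of_card_le hcard
  refine ⟨Function.extend ι Q 0, ?_, ?_⟩
  · intro x
    by_cases hx : ∃ ab, ι ab = x
    · obtain ⟨ab, rfl⟩ := hx
      rw [ι.injective.extend_apply]; exact hQc ab
    · rw [Function.extend_apply' _ _ _ hx]
      refine ctr_of_sq fun v => ?_
      simp only [Pi.zero_apply, Matrix.zero_mulVec]
      simpa using Finset.sum_nonneg fun i _ => sq_nonneg (v i)
  · intro i j k l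
    rw [← hQs]
    symm
    refine Fintype.sum_of_injective ι ι.injective _ _ ?_ ?_
    · intro x hx
      rw [Function.extend_apply' _ _ _ (by simpa using hx)]
      simp
    · intro ab
      rw [ι.injective.extend_apply]

theorem frob {n : ℕ} {X : Type*} [Fintype X] (P : X → Matrix (Fin n) (Fin n) ℝ) (M : ℝ) (hM : 0 ≤ M)
    (hP : ∀ i j k l, ∑ x, P x i j * P x k l = if i = k ∧ j = l then M else 0)
    (a : X → ℝ) (ha : ∀ x, |a x| ≤ 1) :
    ∑ i, ∑ j, (∑ x, a x • P x) i j ^ 2 ≤ M * Fintype.card X := by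
  set w : Matrix (Fin n) (Fin n) ℝ := ∑ x, a x • P x with hw
  let t : X → ℝ := fun x => ∑ i, ∑ j, w i j * P x i j
  have hwij : ∀ i j, w i j = ∑ x, a x * P x i j := by
    intro i j; rw [hw, Matrix.sum_apply]; simp
  set T := ∑ i, ∑ j, w i j ^ 2 with hT
  have h1 : T = ∑ x, a x * t x := by
    simp only [t, Finset.mul_sum]
    rw [Finset.sum_comm, hT]
    refine Finset.sum_congr rfl fun i _ => ?_
    rw [Finset.sum_comm]
    refine Finset.sum_congr rfl fun j _ => ?_
    rw [sq]
    nth_rw 2 [hwij]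
    rw [Finset.mul_sum]
    exact Finset.sum_congr rfl fun x _ => by ring
  have h2 : ∑ x, t x ^ 2 = M * T := by
    have e : ∀ x, t x ^ 2 = ∑ i, ∑ j, ∑ k, ∑ l, w i j * w k l * (P x i j * P x k l) := by
      intro x
      rw [sq]; simp only [t]
      simp only [Finset.sum_mul, Finset.mul_sum]
      refine Finset.sum_congr rfl fun i _ => Finset.sum_congr rfl fun j _ =>
        Finset.sum_congr rfl fun k _ => Finset.sum_congr rfl fun l _ => by ring
    simp only [e]
    rw [Finset.sum_comm, hT, Finset.mul_sum]
    refine Finset.sum_congr rfl fun i _ => ?_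
    rw [Finset.sum_comm, Finset.mul_sum]
    refine Finset.sum_congr rfl fun j _ => ?_
    rw [Finset.sum_comm]
    have : ∀ k, ∑ x, ∑ l, w i j * w k l * (P x i j * P x k l) =
        if i = k then w i j * w k j * M else 0 := by
      intro k
      rw [Finset.sum_comm]
      simp only [← Finset.mul_sum, hP]
      by_cases hik : i = k <;> simp [hik]
    simp only [this]
    simp; ring
  have h3 : T ^ 2 ≤ (∑ x, a x ^ 2) * (M * T) := by
    rw [← h2, h1]
    exact Finset.sum_mul_sq_le_sq_mul_sq _ _ _
  have h4 : ∑ x, a x ^ 2 ≤ Fintype.card X := by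
    have : ∀ x ∈ Finset.univ, a x ^ 2 ≤ 1 := fun x _ => (sq_le_one_iff_abs_le_one _).2 (ha x)
    simpa using Finset.sum_le_sum this
  have hT0 : 0 ≤ T := Finset.sum_nonneg fun i _ => Finset.sum_nonneg fun j _ => sq_nonneg _
  have hMT : 0 ≤ M * T := by rw [← h2]; exact Finset.sum_nonneg fun x _ => sq_nonneg _
  rcases hT0.eq_or_lt with h0 | h0
  · rw [← h0]; positivity
  · have h5 : T * T ≤ (M * Fintype.card X) * T := by
      nlinarith [mul_le_mul_of_nonneg_right h4 hMT]
    exact le_of_mul_le_mul_right h5 h0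

theorem qvec {I : Type*} [Fintype I] (g g' : I → ℝ) (M : ℝ) (hM : 0 < M) (hg : ∑ p, g p ^ 2 = M)
    (hg' : ∑ p, g' p ^ 2 = M) : ∃ φ : I → ℝ, ∑ p, φ p ^ 2 = 1 ∧ M / 2 ≤ |(g ⬝ᵥ φ) * (g' ⬝ᵥ φ)| := by
  obtain ⟨ε, hε, hεt⟩ : ∃ ε : ℝ, ε ^ 2 = 1 ∧ 0 ≤ ε * (g ⬝ᵥ g') := by
    rcases le_total 0 (g ⬝ᵥ g') with h | h
    · exact ⟨1, by norm_num, by simpa using h⟩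
    · exact ⟨-1, by norm_num, by simpa using h⟩
  have e1 : g ⬝ᵥ g = M := by rw [← hg]; simp [dotProduct, sq]
  have e2 : g' ⬝ᵥ g' = M := by rw [← hg']; simp [dotProduct, sq]
  set t := g ⬝ᵥ g' with ht
  have e3 : g' ⬝ᵥ g = t := dotProduct_comm _ _
  set s := Real.sqrt (2 * (M + ε * t)) with hs
  have hs2 : s ^ 2 = 2 * (M + ε * t) := Real.sq_sqrt (by linarith)
  have hs0 : 0 < s := Real.sqrt_pos.2 (by linarith)
  have n1 : g ⬝ᵥ (s⁻¹ • (g + ε • g')) = s⁻¹ * (M + ε * t) := by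
    rw [dotProduct_smul, dotProduct_add, dotProduct_smul, e1, smul_eq_mul, smul_eq_mul]
  have n2 : g' ⬝ᵥ (s⁻¹ • (g + ε • g')) = s⁻¹ * (t + ε * M) := by
    rw [dotProduct_smul, dotProduct_add, dotProduct_smul, e2, e3, smul_eq_mul, smul_eq_mul]
  refine ⟨s⁻¹ • (g + ε • g'), ?_, ?_⟩
  · have : ∑ p, (s⁻¹ • (g + ε • g')) p ^ 2 = (s⁻¹ • (g + ε • g')) ⬝ᵥ (s⁻¹ • (g + ε • g')) := by
      simp [dotProduct, sq]
    rw [this]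
    nth_rw 1 [smul_dotProduct]
    rw [add_dotProduct, smul_dotProduct, n1, n2]
    simp only [smul_eq_mul]
    have : s⁻¹ * (s⁻¹ * (M + ε * t) + ε * (s⁻¹ * (t + ε * M))) =
      (s ^ 2)⁻¹ * ((M + ε * t) + (ε * t + ε ^ 2 * M)) := by rw [← inv_pow]; ring
    rw [this, hε, hs2]
    have : 2 * (M + ε * t) ≠ 0 := by positivity
    field_simp; ring
  · rw [n1, n2]
    have : s⁻¹ * (M + ε * t) * (s⁻¹ * (t + ε * M)) = (s ^ 2)⁻¹ * (M + ε * t) * (t + ε * M) := by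
      rw [← inv_pow]; ring
    rw [this, hs2]
    have h2 : (2 * (M + ε * t))⁻¹ * (M + ε * t) = 1 / 2 := by
      have : M + ε * t ≠ 0 := by positivity
      field_simp
    rw [h2, abs_mul]
    have hεa : |ε| = 1 := by
      have := sq_abs ε; rw [hε] at this
      nlinarith [abs_nonneg ε]
    have h3 : |t + ε * M| = |M + ε * t| := by
      have : M + ε * t = ε * (t + ε * M) := by linear_combination (-M) * hε
      rw [this, abs_mul, hεa, one_mul]
    rw [h3, abs_of_nonneg (by positivity : 0 ≤ M + ε * t)]
    rw [abs_of_nonneg (by norm_num)]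
    linarith

theorem quad_le {I : Type*} [Fintype I] (M : Matrix I I ℂ) (hM : Ctr M) (ψ : I → ℂ)
    (hψ : ∑ p, ‖ψ p‖ ^ 2 = 1) : ‖∑ p, ∑ q, (starRingEnd ℂ) (ψ p) * M p q * ψ q‖ ≤ 1 := by
  have h1 : ∑ p, ∑ q, (starRingEnd ℂ) (ψ p) * M p q * ψ q = ∑ p, (starRingEnd ℂ) (ψ p) * (M *ᵥ ψ) p := by
    simp only [Matrix.mulVec, dotProduct, Finset.mul_sum, mul_assoc]
  rw [h1]
  refine (norm_sum_le _ _).trans ?_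
  simp only [norm_mul, RCLike.norm_conj]
  have h2 := Finset.sum_mul_sq_le_sq_mul_sq Finset.univ (fun p => ‖ψ p‖) (fun p => ‖(M *ᵥ ψ) p‖)
  have h3 := hM ψ
  rw [hψ] at h2 h3
  refine le_sq_aux ?_ zero_le_one
  linarith

theorem qval_le {n₁ n₂ n₃ : ℕ} (G : Fin n₁ → Fin n₂ → Fin n₃ → ℝ) {d : ℕ}
    (ψ : Fin d × Fin d × Fin d → ℂ)
    (A : Fin n₁ → Matrix (Fin d) (Fin d) ℂ) (B : Fin n₂ → Matrix (Fin d) (Fin d) ℂ)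
    (C : Fin n₃ → Matrix (Fin d) (Fin d) ℂ) (hψ : ∑ p, ‖ψ p‖ ^ 2 = 1)
    (hA : ∀ x, IsContraction (A x)) (hB : ∀ y, IsContraction (B y))
    (hC : ∀ z, IsContraction (C z)) :
    ‖(∑ x, ∑ y, ∑ z, (G x y z : ℂ) *
          ∑ p : Fin d × Fin d × Fin d, ∑ q : Fin d × Fin d × Fin d,
            (starRingEnd ℂ) (ψ p) *
              (A x p.1 q.1 * B y p.2.1 q.2.1 * C z p.2.2 q.2.2) * ψ q : ℂ)‖ ≤
      ∑ x, ∑ y, ∑ z, |G x y z| := by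
  refine (norm_sum_le _ _).trans (Finset.sum_le_sum fun x _ => ?_)
  refine (norm_sum_le _ _).trans (Finset.sum_le_sum fun y _ => ?_)
  refine (norm_sum_le _ _).trans (Finset.sum_le_sum fun z _ => ?_)
  rw [norm_mul, Complex.norm_real, Real.norm_eq_abs]
  refine mul_le_of_le_one_right (abs_nonneg _) ?_
  have := quad_le (A x ⊗ₖ (B y ⊗ₖ C z)) (Ctr.kron (hA x) (Ctr.kron (hB y) (hC z))) ψ hψ
  refine le_trans (le_of_eq ?_) this
  congr 1
  refine Finset.sum_congr rfl fun p _ => Finset.sum_congr rfl fun q _ => ?_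
  simp only [Matrix.kroneckerMap_apply]
  ring

theorem ctr_complex {d : ℕ} (P : Matrix (Fin d) (Fin d) ℝ) (h : Ctr P) :
    IsContraction (P.map (fun r : ℝ => (r : ℂ))) := by
  intro v
  have e : ∀ i, ‖((P.map (fun r : ℝ => (r : ℂ))) *ᵥ v) i‖ ^ 2 =
      (P *ᵥ (fun j => (v j).re)) i ^ 2 + (P *ᵥ (fun j => (v j).im)) i ^ 2 := by
    intro i
    rw [Complex.sq_norm, Complex.normSq_apply]
    simp [Matrix.mulVec, dotProduct, sq]
  have e' : ∀ i, ‖v i‖ ^ 2 = (v i).re ^ 2 + (v i).im ^ 2 := by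
    intro i; rw [Complex.sq_norm, Complex.normSq_apply]; ring
  simp only [e, e', Finset.sum_add_distrib]
  exact add_le_add (h.sq _) (h.sq _)

theorem form_kr {n : ℕ} (g g' : Fin n × Fin n × Fin n → ℝ) (A B C : Matrix (Fin n) (Fin n) ℝ) :
    g ⬝ᵥ (kr A B C *ᵥ g') = ∑ p, ∑ q, g p * (A p.1 q.1 * B p.2.1 q.2.1 * C p.2.2 q.2.2) * g' q := by
  simp only [dotProduct, Matrix.mulVec, Finset.mul_sum, kr, Matrix.kroneckerMap_apply]
  refine Finset.sum_congr rfl fun p _ => Finset.sum_congr rfl fun q _ => by ring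

theorem kr_lin {n : ℕ} {X : Type*} [Fintype X] (P : X → Matrix (Fin n) (Fin n) ℝ)
    (g g' : Fin n × Fin n × Fin n → ℝ) (a b c : X → ℝ) :
    ∑ x, ∑ y, ∑ z, (g ⬝ᵥ (kr (P x) (P y) (P z) *ᵥ g')) * a x * b y * c z =
      g ⬝ᵥ (kr (∑ x, a x • P x) (∑ x, b x • P x) (∑ x, c x • P x) *ᵥ g') := by
  have l1 : ∀ (B C : Matrix (Fin n) (Fin n) ℝ),
    g ⬝ᵥ (kr (∑ k, a k • P k) B C *ᵥ g') =
      ∑ k, a k * (g ⬝ᵥ (kr (P k) B C *ᵥ g')) := by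
    intro B C
    let f : Matrix (Fin n) (Fin n) ℝ →ₗ[ℝ] ℝ :=
      ⟨⟨fun X => g ⬝ᵥ (kr X B C *ᵥ g'), by simp [kr, add_kronecker, add_mulVec]⟩,
        by simp [kr, smul_kronecker, smul_mulVec]⟩
    have : f (∑ k, a k • P k) = ∑ k, a k * f (P k) := by
      simp [map_sum]
    exact this
  have l2 : ∀ (A C : Matrix (Fin n) (Fin n) ℝ),
    g ⬝ᵥ (kr A (∑ k, b k • P k) C *ᵥ g') =
      ∑ k, b k * (g ⬝ᵥ (kr A (P k) C *ᵥ g')) := by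
    intro A C
    let f : Matrix (Fin n) (Fin n) ℝ →ₗ[ℝ] ℝ :=
      ⟨⟨fun X => g ⬝ᵥ (kr A X C *ᵥ g'), by simp [kr, add_kronecker, kronecker_add, add_mulVec]⟩,
        by simp [kr, smul_kronecker, kronecker_smul, smul_mulVec]⟩
    have : f (∑ k, b k • P k) = ∑ k, b k * f (P k) := by
      simp [map_sum]
    exact this
  have l3 : ∀ (A B : Matrix (Fin n) (Fin n) ℝ),
    g ⬝ᵥ (kr A B (∑ k, c k • P k) *ᵥ g') =
      ∑ k, c k * (g ⬝ᵥ (kr A B (P k) *ᵥ g')) := by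
    intro A B
    let f : Matrix (Fin n) (Fin n) ℝ →ₗ[ℝ] ℝ :=
      ⟨⟨fun X => g ⬝ᵥ (kr A B X *ᵥ g'), by simp [kr, kronecker_add, add_mulVec]⟩,
        by simp [kr, kronecker_smul, smul_mulVec]⟩
    have : f (∑ k, c k • P k) = ∑ k, c k * f (P k) := by
      simp [map_sum]
    exact this
  rw [l1]
  simp only [l2, l3, Finset.mul_sum]
  refine Finset.sum_congr rfl fun x _ => Finset.sum_congr rfl fun y _ =>
    Finset.sum_congr rfl fun z _ => by ring

theorem kr_orth {n : ℕ} {X : Type*} [Fintype X] (P : X → Matrix (Fin n) (Fin n) ℝ) (M : ℝ)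
    (hP : ∀ i j k l, ∑ x, P x i j * P x k l = if i = k ∧ j = l then M else 0)
    (p q p' q' : Fin n × Fin n × Fin n) :
    ∑ x, ∑ y, ∑ z, kr (P x) (P y) (P z) p q * kr (P x) (P y) (P z) p' q' =
      if p = p' ∧ q = q' then M ^ 3 else 0 := by
  have : ∀ x y z, kr (P x) (P y) (P z) p q * kr (P x) (P y) (P z) p' q' =
    (P x p.1 q.1 * P x p'.1 q'.1) * ((P y p.2.1 q.2.1 * P y p'.2.1 q'.2.1) *
      (P z p.2.2 q.2.2 * P z p'.2.2 q'.2.2)) := by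
    intro x y z; simp only [kr, Matrix.kroneckerMap_apply]; ring
  simp only [this, ← Finset.mul_sum, ← Finset.sum_mul, hP]
  obtain ⟨p1, p2, p3⟩ := p
  obtain ⟨q1, q2, q3⟩ := q
  obtain ⟨r1, r2, r3⟩ := p'
  obtain ⟨s1, s2, s3⟩ := q'
  simp only [Prod.mk.injEq]
  by_cases h1 : p1 = r1 ∧ q1 = s1
  · by_cases h2 : p2 = r2 ∧ q2 = s2
    · by_cases h3 : p3 = r3 ∧ q3 = s3
      · simp [h1, h2, h3]; ring
      · have h : ¬ ((p1 = r1 ∧ p2 = r2 ∧ p3 = r3) ∧ q1 = s1 ∧ q2 = s2 ∧ q3 = s3) := by tauto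
        rw [if_neg h, if_neg h3]; simp
    · have h : ¬ ((p1 = r1 ∧ p2 = r2 ∧ p3 = r3) ∧ q1 = s1 ∧ q2 = s2 ∧ q3 = s3) := by tauto
      rw [if_neg h, if_neg h2]; simp
  · have h : ¬ ((p1 = r1 ∧ p2 = r2 ∧ p3 = r3) ∧ q1 = s1 ∧ q2 = s2 ∧ q3 = s3) := by tauto
    rw [if_neg h, if_neg h1]; simp

theorem bil {R X : Type*} [Fintype R] [DecidableEq R] [Fintype X] (K : X → R → ℝ) (M : ℝ)
    (hK : ∀ r s, ∑ x, K x r * K x s = if r = s then M else 0) (u v : R → ℝ) :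
    ∑ x, (∑ r, u r * K x r) * (∑ s, v s * K x s) = M * ∑ r, u r * v r := by
  simp only [Finset.sum_mul_sum]
  rw [Finset.sum_comm, Finset.mul_sum]
  refine Finset.sum_congr rfl fun r _ => ?_
  rw [Finset.sum_comm]
  have : ∀ s, ∑ x, u r * K x r * (v s * K x s) = u r * v s * (if r = s then M else 0) := by
    intro s
    rw [← hK, Finset.mul_sum]
    exact Finset.sum_congr rfl fun x _ => by ring
  simp only [this]
  simp; ring

theorem quad_val {I X : Type*} [Fintype I] [DecidableEq I] [Fintype X] (K : X → X → X → Matrix I I ℝ) (M : ℝ)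
    (hK : ∀ p q p' q', ∑ x, ∑ y, ∑ z, K x y z p q * K x y z p' q' =
      if p = p' ∧ q = q' then M else 0) (g g' φ : I → ℝ) :
    ∑ x, ∑ y, ∑ z, (g ⬝ᵥ (K x y z *ᵥ g')) * (φ ⬝ᵥ (K x y z *ᵥ φ)) = M * ((g ⬝ᵥ φ) * (g' ⬝ᵥ φ)) := by
  have h := bil (R := I × I) (X := X × X × X) (fun t r => K t.1 t.2.1 t.2.2 r.1 r.2) M
    (by
      rintro ⟨p, q⟩ ⟨p', q'⟩
      simp only [Fintype.sum_prod_type, Prod.mk.injEq]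
      exact hK p q p' q') (fun r => g r.1 * g' r.2) (fun r => φ r.1 * φ r.2)
  simp only [Fintype.sum_prod_type] at h
  have e : ∀ (u w : I → ℝ) (A : Matrix I I ℝ), u ⬝ᵥ (A *ᵥ w) = ∑ p, ∑ q, u p * w q * A p q := by
    intro u w A
    simp only [dotProduct, Matrix.mulVec, Finset.mul_sum]
    exact Finset.sum_congr rfl fun p _ => Finset.sum_congr rfl fun q _ => by ring
  simp only [e]
  rw [h]
  congr 1
  simp only [dotProduct]
  rw [Finset.sum_mul_sum]
  exact Finset.sum_congr rfl fun p _ => Finset.sum_congr rfl fun q _ => by ring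

theorem cbias_le {N : ℕ} (G : Fin N → Fin N → Fin N → ℝ) (B : ℝ)
    (h : ∀ a b c : Fin N → ℝ, (∀ x, |a x| ≤ 1) → (∀ y, |b y| ≤ 1) → (∀ z, |c z| ≤ 1) →
      |∑ x, ∑ y, ∑ z, G x y z * a x * b y * c z| ≤ B) : xorCBias3 G ≤ B := by
  refine csSup_le ⟨_, 0, 0, 0, by simp, by simp, by simp, rfl⟩ ?_
  rintro r ⟨a, b, c, ha, hb, hc, rfl⟩
  exact h a b c ha hb hc

theorem qbias_ge {N : ℕ} (G : Fin N → Fin N → Fin N → ℝ) {d : ℕ} (hd : 1 ≤ d)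
    (φ : Fin d × Fin d × Fin d → ℝ) (hφ : ∑ p, φ p ^ 2 = 1)
    (P : Fin N → Matrix (Fin d) (Fin d) ℝ) (hP : ∀ x, Ctr (P x)) (D : ℕ) (hD : d ≤ D) :
    |∑ x, ∑ y, ∑ z, G x y z * (φ ⬝ᵥ (kr (P x) (P y) (P z) *ᵥ φ))| ≤ xorQBias3Dim D G ∧
    |∑ x, ∑ y, ∑ z, G x y z * (φ ⬝ᵥ (kr (P x) (P y) (P z) *ᵥ φ))| ≤ xorQBias3 G := by
  have hψ : ∑ p, ‖((φ p : ℝ) : ℂ)‖ ^ 2 = 1 := by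
    simpa [Complex.norm_real] using hφ
  have hr : |∑ x, ∑ y, ∑ z, G x y z * (φ ⬝ᵥ (kr (P x) (P y) (P z) *ᵥ φ))| =
      ‖(∑ x, ∑ y, ∑ z, (G x y z : ℂ) *
          ∑ p : Fin d × Fin d × Fin d, ∑ q : Fin d × Fin d × Fin d,
            (starRingEnd ℂ) ((φ p : ℝ) : ℂ) *
              ((P x).map (fun r : ℝ => (r : ℂ)) p.1 q.1 * (P y).map (fun r : ℝ => (r : ℂ)) p.2.1 q.2.1 *
                (P z).map (fun r : ℝ => (r : ℂ)) p.2.2 q.2.2) * ((φ q : ℝ) : ℂ) : ℂ)‖ := by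
    rw [← Real.norm_eq_abs, ← Complex.norm_real]
    congr 1
    simp only [form_kr, Matrix.map_apply, Complex.conj_ofReal]
    push_cast
    rfl
  constructor
  · refine le_csSup ⟨∑ x, ∑ y, ∑ z, |G x y z|, ?_⟩ ?_
    · rintro r ⟨d', ψ, A, B, C, -, -, h1, hA, hB, hC, rfl⟩
      exact qval_le G ψ A B C h1 hA hB hC
    · exact ⟨d, fun p => ((φ p : ℝ) : ℂ), fun x => (P x).map (fun r : ℝ => (r : ℂ)),
        fun x => (P x).map (fun r : ℝ => (r : ℂ)), fun x => (P x).map (fun r : ℝ => (r : ℂ)),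
        hd, hD, hψ, fun x => ctr_complex _ (hP x), fun x => ctr_complex _ (hP x),
        fun x => ctr_complex _ (hP x), hr⟩
  · refine le_csSup ⟨∑ x, ∑ y, ∑ z, |G x y z|, ?_⟩ ?_
    · rintro r ⟨d', ψ, A, B, C, -, h1, hA, hB, hC, rfl⟩
      exact qval_le G ψ A B C h1 hA hB hC
    · exact ⟨d, fun p => ((φ p : ℝ) : ℂ), fun x => (P x).map (fun r : ℝ => (r : ℂ)),
        fun x => (P x).map (fun r : ℝ => (r : ℂ)), fun x => (P x).map (fun r : ℝ => (r : ℂ)),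
        hd, hψ, fun x => ctr_complex _ (hP x), fun x => ctr_complex _ (hP x),
        fun x => ctr_complex _ (hP x), hr⟩

theorem final_arith (κ N : ℕ) (h1 : 1 ≤ κ) (hN : 2 ^ κ ≤ N) (hN' : N < 2 ^ (κ + 1)) :
    1 / 61734912 * (Real.sqrt N / Real.log N ^ ((3 : ℝ) / 2)) *
      (30144 * 2 ^ κ * (2 * Real.sqrt (κ + 1) * (2 * 2 ^ κ * Real.sqrt (2 ^ κ))) ^ 3) ≤
      ((2 : ℝ) ^ κ) ^ 3 * (((2 : ℝ) ^ κ) ^ 3 / 2) := by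
  set n : ℝ := 2 ^ κ with hn
  have hn0 : 0 < n := by positivity
  have hNn : (n : ℝ) ≤ N := by rw [hn]; exact_mod_cast hN
  have hNn' : (N : ℝ) ≤ 2 * n := by
    have : (N : ℝ) < 2 ^ (κ + 1) := by exact_mod_cast hN'
    rw [pow_succ] at this; linarith
  have hlog : (κ : ℝ) + 1 ≤ 4 * Real.log N := by
    have a1 : Real.log n ≤ Real.log N := Real.log_le_log hn0 hNn
    rw [hn, Real.log_pow] at a1
    have a2 := Real.log_two_gt_d9
    have a3 : (1 : ℝ) ≤ κ := by exact_mod_cast h1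
    nlinarith
  have hlog0 : 0 < Real.log N := by
    have : (0 : ℝ) ≤ κ := by positivity
    linarith
  set l := Real.sqrt (Real.log N) with hl
  have hl0 : 0 < l := Real.sqrt_pos.2 hlog0
  have e1 : Real.log N ^ ((3 : ℝ) / 2) = l ^ 3 := by
    rw [hl, Real.sqrt_eq_rpow, ← Real.rpow_natCast, ← Real.rpow_mul hlog0.le]
    norm_num
  have e2 : Real.sqrt (κ + 1) ≤ 2 * l := by
    rw [Real.sqrt_le_left (by positivity), mul_pow, hl, Real.sq_sqrt hlog0.le]
    linarith
  set s := Real.sqrt n with hs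
  have hs2 : s ^ 2 = n := Real.sq_sqrt hn0.le
  have hs0 : 0 < s := Real.sqrt_pos.2 hn0
  have e3 : Real.sqrt N ≤ 2 * s := by
    rw [Real.sqrt_le_left (by positivity), mul_pow, hs2]
    linarith
  rw [e1]
  calc _ ≤ 1 / 61734912 * (2 * s / l ^ 3) * (30144 * n * (2 * (2 * l) * (2 * n * s)) ^ 3) := by
        gcongr
    _ = n ^ 4 * (s ^ 2) ^ 2 / 2 := by
        field_simp
        ring
    _ ≤ _ := by rw [hs2]; apply le_of_eq; ring
theorem comb (c β B T m q : ℝ) (hc : 0 ≤ c) (hT : 0 ≤ T) (h1 : β ≤ T * B) (h2 : c * B ≤ m)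
    (h3 : m ≤ q) : c * β ≤ T * q := by
  have a1 := mul_le_mul_of_nonneg_left h1 hc
  have a2 := mul_le_mul_of_nonneg_left (h2.trans h3) hT
  linarith [mul_left_comm c T B]

theorem stmt6_aux :
    ∃ C : ℝ, 0 < C ∧
      ∀ n : ℕ, 2 ≤ n →
        ∃ G : Fin (n ^ 2) → Fin (n ^ 2) → Fin (n ^ 2) → ℝ,
          (∑ x, ∑ y, ∑ z, |G x y z| = 1) ∧
          C * (Real.sqrt n / Real.log n ^ ((3 : ℝ) / 2)) * xorCBias3 G ≤
            xorQBias3Dim n G ∧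
          C * (Real.sqrt n / Real.log n ^ ((3 : ℝ) / 2)) * xorCBias3 G ≤
            xorQBias3 G := by
  refine ⟨1 / 61734912, by norm_num, ?_⟩
  intro N hN2
  set κ := Nat.log 2 N with hκ
  have h1 : 1 ≤ κ := Nat.log_pos (by norm_num) hN2
  have hN : 2 ^ κ ≤ N := Nat.pow_log_le_self 2 (by omega)
  have hN' : N < 2 ^ (κ + 1) := Nat.lt_pow_succ_log_self (by norm_num) N
  clear_value κ
  obtain ⟨P, hPc, hP⟩ := pauli κ N hN
  obtain ⟨g, g', hg, hg', hb⟩ := step4 κ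
  have hsq : ∀ g : Fin (2 ^ κ) × Fin (2 ^ κ) × Fin (2 ^ κ) → ℝ, (∀ p, g p = 1 ∨ g p = -1) →
      ∑ p, g p ^ 2 = ((2 : ℝ) ^ κ) ^ 3 := by
    intro g hg
    have : ∀ p, g p ^ 2 = 1 := by
      intro p; rcases hg p with h | h <;> rw [h] <;> norm_num
    simp only [this]
    simp [Fintype.card_prod]
    ring
  obtain ⟨φ, hφ, hφ2⟩ := qvec g g' (((2 : ℝ) ^ κ) ^ 3) (by positivity) (hsq g hg) (hsq g' hg')
  let G0 : Fin (N ^ 2) → Fin (N ^ 2) → Fin (N ^ 2) → ℝ :=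
    fun x y z => g ⬝ᵥ (kr (P x) (P y) (P z) *ᵥ g')
  set n : ℝ := 2 ^ κ with hn
  have hn0 : 0 < n := by positivity
  have hcl : ∀ a b c : Fin (N ^ 2) → ℝ, (∀ x, |a x| ≤ 1) → (∀ y, |b y| ≤ 1) → (∀ z, |c z| ≤ 1) →
      |∑ x, ∑ y, ∑ z, G0 x y z * a x * b y * c z| ≤
        30144 * n * (2 * Real.sqrt (κ + 1) * (2 * n * Real.sqrt n)) ^ 3 := by
    intro a b c ha hb' hc
    have hF : ∀ a : Fin (N ^ 2) → ℝ, (∀ x, |a x| ≤ 1) →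
        ∑ i, ∑ j, (∑ x, a x • P x) i j ^ 2 ≤ (2 * n * Real.sqrt n) ^ 2 := by
      intro a ha
      refine (frob P n hn0.le hP a ha).trans ?_
      rw [Fintype.card_fin, mul_pow, Real.sq_sqrt hn0.le]
      have hle : (N : ℝ) ≤ 2 * n := by
        have : (N : ℝ) < 2 ^ (κ + 1) := by exact_mod_cast hN'
        rw [pow_succ] at this; linarith
      push_cast
      have : (N : ℝ) ^ 2 ≤ (2 * n) ^ 2 := by gcongr
      nlinarith
    have := kr_lin P g g' a b c
    simp only [G0]
    rw [this]
    exact hb _ _ _ _ (by positivity) (hF a ha) (hF b hb') (hF c hc)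
  have hq : ∑ x, ∑ y, ∑ z, G0 x y z * (φ ⬝ᵥ (kr (P x) (P y) (P z) *ᵥ φ)) =
      n ^ 3 * ((g ⬝ᵥ φ) * (g' ⬝ᵥ φ)) :=
    quad_val (fun x y z => kr (P x) (P y) (P z)) (n ^ 3) (kr_orth P n hP) g g' φ
  have hq2 : n ^ 3 * (n ^ 3 / 2) ≤ |∑ x, ∑ y, ∑ z, G0 x y z * (φ ⬝ᵥ (kr (P x) (P y) (P z) *ᵥ φ))| := by
    rw [hq, abs_mul, abs_of_nonneg (pow_nonneg hn0.le 3)]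
    gcongr
  have hS0 : 0 ≤ ∑ x, ∑ y, ∑ z, |G0 x y z| :=
    Finset.sum_nonneg fun x _ => Finset.sum_nonneg fun y _ => Finset.sum_nonneg fun z _ => abs_nonneg _
  have hS : 0 < ∑ x, ∑ y, ∑ z, |G0 x y z| := by
    refine lt_of_le_of_ne hS0 fun h => ?_
    have hz : ∀ x y z, G0 x y z = 0 := by
      intro x y z
      have a1 := (Finset.sum_eq_zero_iff_of_nonneg (fun x _ => Finset.sum_nonneg fun y _ =>
        Finset.sum_nonneg fun z _ => abs_nonneg _)).1 h.symm x (Finset.mem_univ _)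
      have a2 := (Finset.sum_eq_zero_iff_of_nonneg (fun y _ =>
        Finset.sum_nonneg fun z _ => abs_nonneg _)).1 a1 y (Finset.mem_univ _)
      have a3 := (Finset.sum_eq_zero_iff_of_nonneg (fun z _ => abs_nonneg _)).1 a2 z (Finset.mem_univ _)
      exact abs_eq_zero.1 a3
    simp only [hz, zero_mul, Finset.sum_const_zero, abs_zero] at hq2
    have : 0 < n ^ 3 * (n ^ 3 / 2) := by positivity
    linarith
  set S := ∑ x, ∑ y, ∑ z, |G0 x y z| with hSdef
  have hC : xorCBias3 (fun x y z => S⁻¹ * G0 x y z) ≤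
      S⁻¹ * (30144 * n * (2 * Real.sqrt (κ + 1) * (2 * n * Real.sqrt n)) ^ 3) := by
    refine cbias_le _ _ fun a b c ha hb' hc => ?_
    have : ∑ x, ∑ y, ∑ z, S⁻¹ * G0 x y z * a x * b y * c z =
        S⁻¹ * ∑ x, ∑ y, ∑ z, G0 x y z * a x * b y * c z := by
      simp only [Finset.mul_sum, mul_assoc]
    rw [this, abs_mul, abs_of_nonneg (inv_nonneg.2 hS0)]
    exact mul_le_mul_of_nonneg_left (hcl a b c ha hb' hc) (inv_nonneg.2 hS0)
  have hQ := qbias_ge (fun x y z => S⁻¹ * G0 x y z) Nat.one_le_two_pow φ hφ P hPc N hN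
  have hQe : ∑ x, ∑ y, ∑ z, S⁻¹ * G0 x y z * (φ ⬝ᵥ (kr (P x) (P y) (P z) *ᵥ φ)) =
        S⁻¹ * ∑ x, ∑ y, ∑ z, G0 x y z * (φ ⬝ᵥ (kr (P x) (P y) (P z) *ᵥ φ)) := by
      simp only [Finset.mul_sum, mul_assoc]
  rw [hQe, abs_mul, abs_of_nonneg (inv_nonneg.2 hS0)] at hQ
  have hlogN : 0 ≤ Real.log N := Real.log_natCast_nonneg N
  have hc0 : 0 ≤ 1 / 61734912 * (Real.sqrt N / Real.log N ^ ((3 : ℝ) / 2)) :=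
    mul_nonneg (by norm_num) (div_nonneg (Real.sqrt_nonneg _) (Real.rpow_nonneg hlogN _))
  have hmain : 1 / 61734912 * (Real.sqrt N / Real.log N ^ ((3 : ℝ) / 2)) *
      xorCBias3 (fun x y z => S⁻¹ * G0 x y z) ≤
      S⁻¹ * |∑ x, ∑ y, ∑ z, G0 x y z * (φ ⬝ᵥ (kr (P x) (P y) (P z) *ᵥ φ))| := by
    exact comb _ _ _ _ _ _ hc0 (inv_nonneg.2 hS0) hC (final_arith κ N h1 hN hN') hq2
  refine ⟨fun x y z => S⁻¹ * G0 x y z, ?_, hmain.trans hQ.1, hmain.trans hQ.2⟩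
  simp only [abs_mul, ← Finset.mul_sum]
  rw [← hSdef, abs_of_nonneg (inv_nonneg.2 hS0)]
  exact inv_mul_cancel₀ hS.ne'

end helpers

/-- unbounded violations for three-player XOR games: there is `C > 0`
such that for every `n ≥ 2` there is a three-player XOR game tensor with `n²` questions
per player, normalized so that `Σ|Ĝ| = 1`, whose entangled bias — already in local
dimension `n` per player — exceeds `C √n / log^{3/2} n` times its classical bias. -/
theorem stmt6 :
    ∃ C : ℝ, 0 < C ∧
      ∀ n : ℕ, 2 ≤ n →
        ∃ G : Fin (n ^ 2) → Fin (n ^ 2) → Fin (n ^ 2) → ℝ,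
          (∑ x, ∑ y, ∑ z, |G x y z| = 1) ∧
          C * (Real.sqrt n / Real.log n ^ ((3 : ℝ) / 2)) * xorCBias3 G ≤
            xorQBias3Dim n G ∧
          C * (Real.sqrt n / Real.log n ^ ((3 : ℝ) / 2)) * xorCBias3 G ≤
            xorQBias3 G := by
  exact stmt6_aux
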